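/- arXiv:1608.02468 — 10 statements merged into one kernel-verified Lean document; each statement's English description precedes it below -/
import Mathlib

section
/- Let 𝒮 and 𝒯 be admissible families of finite subsets of ℕ with ρ(𝒮) = α and ρ(𝒯) = β, and let 𝒮 ⊕ 𝒯 = {S ∪ T : S ∈ 𝒮, T ∈ 𝒯}. Then 𝒮 ⊕ 𝒯 is an admissible family and ρ(𝒮 ⊕ 𝒯) < (α+1)·(β+1) in ordinal arithmetic (equivalently, ρ(𝒮 ⊕ 𝒯) ≤ (α+1)·(β+1) − 1). -/
open Ordinal Filter
open scoped ENNReal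
/-- `A ≤ₛ B`: same cardinality and the increasing enumeration of `A` is pointwise `≤`
that of `B`. -/
def SpreadLE (A B : Finset ℕ) : Prop :=
  List.Forall₂ (· ≤ ·) (A.sort (· ≤ ·)) (B.sort (· ≤ ·))
/-- An admissible family of finite subsets of `ℕ`: compact (as a set of characteristic
functions in `2^ℕ`), hereditary, spreading, and containing all singletons. -/
structure IsAdmissibleFamily (S : Set (Finset ℕ)) : Prop where
  compact : IsCompact {f : ℕ → Bool | ∃ A ∈ S, f = fun n => decide (n ∈ A)}
  hereditary : ∀ A ∈ S, ∀ B ⊆ A, B ∈ S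
  spreading : ∀ A ∈ S, ∀ B, SpreadLE A B → B ∈ S
  singletons : ∀ n : ℕ, ({n} : Finset ℕ) ∈ S
/-- One-step extension relation on the tree `T_S` of strictly increasing finite sequences
of naturals whose range lies in `S`; going down in this relation means properly extending
the sequence (reverse end-extension). -/
def treeRel (S : Set (Finset ℕ)) (s t : List ℕ) : Prop :=
  s.Chain' (· < ·) ∧ s.toFinset ∈ S ∧ ∃ n, s = t ++ [n]

open Classical in
/-- `ρ(S)`: the well-founded rank of the tree `T_S`, i.e. the rank of its root `[]`. -/
noncomputable def rho (S : Set (Finset ℕ)) : Ordinal :=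
  if h : WellFounded (treeRel S) then (h.apply ([] : List ℕ)).rank else 0

/-- `𝒮 ⊕ 𝒯 = {S ∪ T : S ∈ 𝒮, T ∈ 𝒯}`. -/
def oplusFam (S T : Set (Finset ℕ)) : Set (Finset ℕ) :=
  {C | ∃ A ∈ S, ∃ B ∈ T, C = A ∪ B}

theorem aux_wf {S : Set (Finset ℕ)} (hS : IsAdmissibleFamily S) : WellFounded (treeRel S) := by
  rw [wellFounded_iff_isEmpty_descending_chain]
  refine ⟨?_⟩
  rintro ⟨f, hf⟩
  have hlen : ∀ k, k ≤ (f k).length := by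
    intro k
    induction k with
    | zero => simp
    | succ k ih =>
      obtain ⟨-, -, n, hn⟩ := hf k
      rw [hn]; simpa using ih
  have hmono : ∀ j k, j ≤ k → ∀ m ∈ f j, m ∈ f k := by
    intro j k hjk
    induction k, hjk using Nat.le_induction with
    | base => exact fun m h => h
    | succ k hk ih =>
      intro m hm
      obtain ⟨-, -, n, hn⟩ := hf k
      rw [hn]; simp [ih m hm]
  classical
  have hcl := hS.compact.isClosed
  have hmem : (fun m => decide (∃ k, m ∈ f k)) ∈
      {f : ℕ → Bool | ∃ A ∈ S, f = fun n => decide (n ∈ A)} := by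
    refine hcl.mem_of_tendsto (b := atTop)
      (f := fun k : ℕ => fun m => decide (m ∈ (f (k+1)).toFinset)) ?_ ?_
    · rw [tendsto_pi_nhds]
      intro m
      apply tendsto_const_nhds.congr'
      by_cases h : ∃ k, m ∈ f k
      · obtain ⟨k, hk⟩ := h
        filter_upwards [eventually_ge_atTop k] with j hj
        have h1 := hmono k (j+1) (by omega) m hk
        have h2 : ∃ k, m ∈ f k := ⟨k, hk⟩
        simp [h1, h2]
      · refine Eventually.of_forall fun j => ?_
        have h1 : m ∉ f (j+1) := fun h' => h ⟨_, h'⟩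
        simp only [h, h1, List.mem_toFinset]
    · exact Eventually.of_forall fun k => ⟨_, (hf k).2.1, rfl⟩
  obtain ⟨A, -, hA⟩ := hmem
  have hsub : (f (A.card + 1)).toFinset ⊆ A := by
    intro m hm
    have := congrFun hA m
    have h2 : ∃ k, m ∈ f k := ⟨_, by simpa using hm⟩
    simpa [h2] using this
  have hnd : (f (A.card + 1)).Nodup := by
    have := (hf A.card).1
    exact (List.isChain_iff_pairwise.1 this).imp (fun h => ne_of_lt h)
  have h1 := Finset.card_le_card hsub
  rw [List.toFinset_card_of_nodup hnd] at h1
  have := hlen (A.card + 1)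
  omega

theorem aux_rank_le {r : List ℕ → List ℕ → Prop} (h : WellFounded r) (f : List ℕ → Ordinal.{0})
    (hf : ∀ a b, r a b → f a < f b) (a : List ℕ) : (h.apply a).rank ≤ f a := by
  induction a using h.induction with
  | _ a ih =>
    rw [Acc.rank_eq]
    apply Ordinal.iSup_le
    rintro ⟨b, hb⟩
    exact Order.succ_le_of_lt ((ih b hb).trans_lt (hf b a hb))

theorem aux_rank_le_root {S : Set (Finset ℕ)} (hS : IsAdmissibleFamily S)
    (h : WellFounded (treeRel S)) (l : List ℕ) (hl : l.Pairwise (· < ·)) (hm : l.toFinset ∈ S) :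
    (h.apply l).rank ≤ (h.apply []).rank := by
  induction l using List.reverseRecOn with
  | nil => exact le_rfl
  | append_singleton l n ih =>
    have h1 : (h.apply (l ++ [n])).rank < (h.apply l).rank :=
      Acc.rank_lt_of_rel (h.apply l) ⟨List.isChain_iff_pairwise.2 hl, hm, n, rfl⟩
    refine h1.le.trans (ih ?_ ?_)
    · exact (List.pairwise_append.1 hl).1
    · refine hS.hereditary _ hm _ ?_
      intro x; simp; tauto

theorem aux_sort_eq (A : Finset ℕ) (l : List ℕ) (hl : l.Pairwise (· < ·)) (h : l.toFinset = A) :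
    A.sort (· ≤ ·) = l := by
  subst h
  exact List.toFinset_sort (· ≤ ·) (hl.imp ne_of_lt) |>.2 (hl.imp le_of_lt)

theorem aux_sort_erase (A : Finset ℕ) (n : ℕ) (hn : n ∈ A) (h : ∀ x ∈ A, x ≤ n) :
    A.sort (· ≤ ·) = (A.erase n).sort (· ≤ ·) ++ [n] := by
  apply aux_sort_eq
  · rw [List.pairwise_append]
    refine ⟨Finset.sortedLT_sort _ |>.pairwise, by simp, ?_⟩
    intro a ha b hb
    simp at ha hb
    have := h a ha.2
    omega
  · ext x
    simp
    by_cases hx : x = n <;> simp [hx, hn]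

theorem aux_lists (l l' : List ℕ) (hl : l.Pairwise (· < ·)) (hl' : l'.Pairwise (· < ·))
    (h : List.Forall₂ (· ≤ ·) l l') :
    ∃ φ : ℕ → ℕ, l.map φ = l' ∧ (∀ x ∈ l, x ≤ φ x) ∧ ∀ x ∈ l, ∀ y ∈ l, x < y → φ x < φ y := by
  induction h with
  | nil => exact ⟨id, by simp⟩
  | @cons a b l l' hab h ih =>
    rw [List.pairwise_cons] at hl hl'
    obtain ⟨φ, h1, h2, h3⟩ := ih hl.2 hl'.2
    have hne : ∀ x ∈ l, Function.update φ a b x = φ x := by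
      intro x hx
      rw [Function.update_of_ne]
      exact (hl.1 x hx).ne'
    refine ⟨Function.update φ a b, ?_, ?_, ?_⟩
    · simp only [List.map_cons, Function.update_self]
      rw [List.map_congr_left hne, h1]
    · intro x hx
      rcases List.mem_cons.1 hx with rfl | hx
      · simpa using hab
      · rw [hne x hx]; exact h2 x hx
    · intro x hx y hy hxy
      rcases List.mem_cons.1 hx with rfl | hx2
      · rcases List.mem_cons.1 hy with rfl | hy
        · omega
        · rw [hne y hy, Function.update_self]
          exact hl'.1 _ (h1 ▸ List.mem_map_of_mem hy)
      · rcases List.mem_cons.1 hy with rfl | hy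
        · have := hl.1 x hx2
          omega
        · rw [hne x hx2, hne y hy]; exact h3 x hx2 y hy hxy

theorem aux_spread_image (A : Finset ℕ) (φ : ℕ → ℕ) (h2 : ∀ x ∈ A, x ≤ φ x)
    (h3 : ∀ x ∈ A, ∀ y ∈ A, x < y → φ x < φ y) : SpreadLE A (A.image φ) := by
  unfold SpreadLE
  rw [aux_sort_eq (A.image φ) ((A.sort (· ≤ ·)).map φ)]
  · rw [List.forall₂_map_right_iff, List.forall₂_same]
    intro x hx
    exact h2 x (by simpa using hx)
  · rw [List.pairwise_map]
    refine (Finset.sortedLT_sort A).pairwise.imp_of_mem ?_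
    intro a b ha hb hab
    exact h3 a (by simpa using ha) b (by simpa using hb) hab
  · ext x; simp

theorem aux_adm {S T : Set (Finset ℕ)} (hS : IsAdmissibleFamily S) (hT : IsAdmissibleFamily T) :
    IsAdmissibleFamily (oplusFam S T) where
  compact := by
    have hc : Continuous (fun p : (ℕ → Bool) × (ℕ → Bool) => fun n => (p.1 n || p.2 n)) := by
      refine continuous_pi fun n => ?_
      have h0 : Continuous (fun q : Bool × Bool => (q.1 || q.2)) := continuous_of_discreteTopology
      have h1 : Continuous (fun p : (ℕ → Bool) × (ℕ → Bool) => (p.1 n, p.2 n)) := by fun_prop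
      exact h0.comp h1
    convert (hS.compact.prod hT.compact).image hc using 1
    ext f
    constructor
    · rintro ⟨C, ⟨A, hA, B, hB, rfl⟩, rfl⟩
      exact ⟨(fun n => decide (n ∈ A), fun n => decide (n ∈ B)), ⟨⟨A, hA, rfl⟩, ⟨B, hB, rfl⟩⟩,
        by ext n; simp⟩
    · rintro ⟨⟨_, _⟩, ⟨⟨A, hA, rfl⟩, ⟨B, hB, rfl⟩⟩, rfl⟩
      exact ⟨A ∪ B, ⟨A, hA, B, hB, rfl⟩, by ext n; simp⟩
  hereditary := by
    rintro _ ⟨A, hA, B, hB, rfl⟩ C hC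
    refine ⟨C ∩ A, hS.hereditary A hA _ Finset.inter_subset_right, C ∩ B,
      hT.hereditary B hB _ Finset.inter_subset_right, ?_⟩
    rw [← Finset.inter_union_distrib_left]
    exact (Finset.inter_eq_left.2 hC).symm
  spreading := by
    rintro _ ⟨A, hA, B, hB, rfl⟩ C hC
    obtain ⟨φ, h1, h2, h3⟩ := aux_lists _ _ (Finset.sortedLT_sort _).pairwise
      (Finset.sortedLT_sort _).pairwise hC
    simp only [Finset.mem_sort] at h2 h3
    refine ⟨A.image φ, hS.spreading A hA _ (aux_spread_image A φ ?_ ?_), B.image φ,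
      hT.spreading B hB _ (aux_spread_image B φ ?_ ?_), ?_⟩
    · exact fun x hx => h2 x (Finset.mem_union_left _ hx)
    · exact fun x hx y hy => h3 x (Finset.mem_union_left _ hx) y (Finset.mem_union_left _ hy)
    · exact fun x hx => h2 x (Finset.mem_union_right _ hx)
    · exact fun x hx y hy => h3 x (Finset.mem_union_right _ hx) y (Finset.mem_union_right _ hy)
    · rw [← Finset.image_union]
      ext x
      have : x ∈ C ↔ x ∈ C.sort (· ≤ ·) := by simp
      rw [this, ← h1]
      simp
  singletons := fun n => ⟨{n}, hS.singletons n, {n}, hT.singletons n, by simp⟩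

theorem aux_step {S : Set (Finset ℕ)} (hS : IsAdmissibleFamily S) (h : WellFounded (treeRel S))
    (A : Finset ℕ) (hA : A ∈ S) (n : ℕ) (hn : n ∈ A) (hmax : ∀ x ∈ A, x ≤ n) :
    (h.apply (A.sort (· ≤ ·))).rank < (h.apply ((A.erase n).sort (· ≤ ·))).rank := by
  apply Acc.rank_lt_of_rel
  refine ⟨List.isChain_iff_pairwise.2 (Finset.sortedLT_sort _).pairwise, ?_, n, aux_sort_erase A n hn hmax⟩
  simpa using hA

theorem aux_lex {α a a' b b' : Ordinal.{0}} (ha' : a' ≤ α)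
    (h : b' < b ∨ (b' = b ∧ a' < a)) : (α + 1) * b' + a' < (α + 1) * b + a := by
  rcases h with h | ⟨rfl, h⟩
  · calc (α + 1) * b' + a' < (α + 1) * b' + (α + 1) := by
          gcongr
          exact Order.lt_add_one_iff.2 ha'
      _ = (α + 1) * (b' + 1) := by rw [mul_add_one]
      _ ≤ (α + 1) * b := by
          gcongr
          exact Order.add_one_le_of_lt h
      _ ≤ _ := le_self_add
  · gcongr

/-- If `𝒮` and `𝒯` are admissible families with `ρ(𝒮) = α` and `ρ(𝒯) = β`, then
`𝒮 ⊕ 𝒯` is admissible and `ρ(𝒮 ⊕ 𝒯) < (α+1)·(β+1)`. -/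
theorem oplus_admissible_and_rho_lt (S T : Set (Finset ℕ))
    (hS : IsAdmissibleFamily S) (hT : IsAdmissibleFamily T)
    (α β : Ordinal) (hα : rho S = α) (hβ : rho T = β) :
    IsAdmissibleFamily (oplusFam S T) ∧ rho (oplusFam S T) < (α + 1) * (β + 1) := by
  refine ⟨aux_adm hS hT, ?_⟩
  classical
  have wS := aux_wf hS
  have wT := aux_wf hT
  have wU := aux_wf (aux_adm hS hT)
  rw [rho, dif_pos wS] at hα
  rw [rho, dif_pos wT] at hβ
  rw [rho, dif_pos wU]
  let rS : Finset ℕ → Ordinal.{0} := fun A => (wS.apply (A.sort (· ≤ ·))).rank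
  let rT : Finset ℕ → Ordinal.{0} := fun A => (wT.apply (A.sort (· ≤ ·))).rank
  have hrS : ∀ A ∈ S, rS A ≤ α := fun A hA => hα ▸
    aux_rank_le_root hS wS _ (Finset.sortedLT_sort _).pairwise (by simpa using hA)
  have hrT : ∀ A ∈ T, rT A ≤ β := fun A hA => hβ ▸
    aux_rank_le_root hT wT _ (Finset.sortedLT_sort _).pairwise (by simpa using hA)
  let g : Finset ℕ × Finset ℕ → Ordinal.{0} := fun p => (α + 1) * rT p.2 + rS p.1
  let D : List ℕ → Finset (Finset ℕ × Finset ℕ) := fun l =>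
    (l.toFinset.powerset ×ˢ l.toFinset.powerset).filter
      (fun p => p.1 ∈ S ∧ p.2 ∈ T ∧ l.toFinset = p.1 ∪ p.2)
  have hD : ∀ l p, p ∈ D l ↔ (p.1 ∈ S ∧ p.2 ∈ T ∧ l.toFinset = p.1 ∪ p.2) := by
    intro l p
    simp only [D, Finset.mem_filter, Finset.mem_product, Finset.mem_powerset]
    constructor
    · exact fun h => h.2
    · intro h
      refine ⟨?_, h⟩
      rw [h.2.2]
      exact ⟨Finset.subset_union_left, Finset.subset_union_right⟩
  let f : List ℕ → Ordinal.{0} := fun l => (D l).sup g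
  have key : ∀ a b, treeRel (oplusFam S T) a b → f a < f b := by
    rintro _ b ⟨hc, hm, n, rfl⟩
    have hb := List.isChain_iff_pairwise.1 hc
    rw [List.pairwise_append] at hb
    have hlt : ∀ x ∈ b, x < n := fun x hx => hb.2.2 x hx n (by simp)
    have step : ∀ p ∈ D (b ++ [n]), g p < f b := by
      rintro ⟨A, B⟩ hp
      obtain ⟨hA, hB, hAB⟩ := (hD _ _).1 hp
      simp only at hA hB hAB
      have hx : ∀ x, (x ∈ b ∨ x = n) ↔ (x ∈ A ∨ x ∈ B) := by
        intro x
        have := congrArg (x ∈ ·) hAB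
        simpa [or_comm (a := x = n)] using this
      have hnb : n ∉ b := fun h => lt_irrefl _ (hlt n h)
      have hle : ∀ x, (x ∈ A ∨ x ∈ B) → x ≤ n := by
        intro x h
        rcases (hx x).2 h with h | h
        · exact (hlt x h).le
        · exact h.le
      have hq : (A.erase n, B.erase n) ∈ D b := by
        rw [hD]
        refine ⟨hS.hereditary A hA _ (Finset.erase_subset _ _),
          hT.hereditary B hB _ (Finset.erase_subset _ _), ?_⟩
        ext x
        have := hx x
        simp only [List.mem_toFinset, Finset.mem_union, Finset.mem_erase]
        by_cases hxn : x = n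
        · subst hxn; simp [hnb]
        · simp only [hxn, or_false] at this
          simp [hxn, this]
      refine lt_of_lt_of_le ?_ (Finset.le_sup (f := g) hq)
      refine aux_lex (hrS A hA) ?_
      by_cases hnB : n ∈ B
      · exact Or.inl (aux_step hT wT B hB n hnB fun x h => hle x (Or.inr h))
      · right
        have hnA : n ∈ A := ((hx n).1 (Or.inr rfl)).resolve_right hnB
        refine ⟨?_, aux_step hS wS A hA n hnA fun x h => hle x (Or.inl h)⟩
        simp only [Finset.erase_eq_of_notMem hnB]
    obtain ⟨A, hA, B, hB, hAB⟩ := hm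
    have h0 := step (A, B) ((hD _ _).2 ⟨hA, hB, hAB⟩)
    exact (Finset.sup_lt_iff (lt_of_le_of_lt bot_le h0)).2 step
  refine (aux_rank_le wU f key []).trans_lt ?_
  have hpos : (⊥ : Ordinal.{0}) < (α + 1) * (β + 1) := by
    rw [Ordinal.bot_eq_zero]
    exact mul_pos (by simp) (by simp)
  refine (Finset.sup_lt_iff hpos).2 ?_
  rintro p hp
  obtain ⟨hA, hB, -⟩ := (hD _ _).1 hp
  have := aux_lex (a := 0) (b := β + 1) (b' := rT p.2) (hrS p.1 hA)
    (Or.inl (Order.lt_add_one_iff.2 (hrT p.2 hB)))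
  simpa using this
end

section
/- Let 𝒮 be an admissible family of finite subsets of ℕ with ρ(𝒮) = α, let ‖·‖_𝒮 be the derived covering norm, and for an integer n > 0 let 𝒮ⁿ = {F ⊆ ℕ finite : ‖F‖_𝒮 ≤ n}. Then ρ(𝒮ⁿ) < (α+1)ⁿ in ordinal arithmetic (equivalently, ρ(𝒮ⁿ) ≤ (α+1)ⁿ − 1). -/
open Ordinal Filter
open scoped ENNReal
/-- The covering norm derived from a family `S`: the least number of members of `S`
needed to cover `A`. -/
noncomputable def normOf (S : Set (Finset ℕ)) (A : Finset ℕ) : ℕ :=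
  sInf {n | ∃ c : Finset (Finset ℕ), ↑c ⊆ S ∧ c.card = n ∧ A ⊆ c.biUnion id}


inductive RkLE (S : Set (Finset ℕ)) : List ℕ → Ordinal.{0} → Prop
  | mk (t : List ℕ) (δ : Ordinal.{0}) (f : List ℕ → Ordinal.{0})
      (h1 : ∀ s, treeRel S s t → f s < δ)
      (h2 : ∀ s, treeRel S s t → RkLE S s (f s)) : RkLE S t δ

theorem RkLE.mono {S : Set (Finset ℕ)} {t : List ℕ} {δ ε : Ordinal.{0}} (h : RkLE S t δ)
    (hle : δ ≤ ε) : RkLE S t ε := by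
  cases h with
  | mk _ _ f h1 h2 => exact ⟨_, _, f, fun s hs => (h1 s hs).trans_le hle, h2⟩

theorem RkLE.intro' {S : Set (Finset ℕ)} {t : List ℕ} {δ : Ordinal.{0}}
    (h : ∀ s, treeRel S s t → ∃ ε < δ, RkLE S s ε) : RkLE S t δ := by
  classical
  refine ⟨_, _, fun s => if hs : treeRel S s t then (h s hs).choose else 0, ?_, ?_⟩
  · intro s hs
    simp only [hs, dif_pos]
    exact (h s hs).choose_spec.1
  · intro s hs
    simp only [hs, dif_pos]
    exact (h s hs).choose_spec.2

theorem RkLE.elim' {S : Set (Finset ℕ)} {t : List ℕ} {δ : Ordinal.{0}} (h : RkLE S t δ)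
    {s : List ℕ} (hs : treeRel S s t) : ∃ ε < δ, RkLE S s ε := by
  cases h with
  | mk _ _ f h1 h2 => exact ⟨f s, h1 s hs, h2 s hs⟩

theorem RkLE.of_subset {S T : Set (Finset ℕ)} (hST : S ⊆ T) {t : List ℕ} {δ : Ordinal.{0}}
    (h : RkLE T t δ) : RkLE S t δ := by
  induction h with
  | mk t δ f h1 h2 ih =>
    exact ⟨_, _, f, fun s hs => h1 s ⟨hs.1, hST hs.2.1, hs.2.2⟩,
      fun s hs => ih s ⟨hs.1, hST hs.2.1, hs.2.2⟩⟩

theorem RkLE.rank_le {S : Set (Finset ℕ)} {t : List ℕ} {δ : Ordinal.{0}} (h : RkLE S t δ) :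
    ∀ ha : Acc (treeRel S) t, ha.rank ≤ δ := by
  induction h with
  | mk t δ f h1 h2 ih =>
    intro ha
    rw [Acc.rank_eq]
    apply Ordinal.iSup_le
    rintro ⟨s, hs⟩
    exact Order.succ_le_of_lt ((ih s hs _).trans_lt (h1 s hs))

theorem RkLE.of_acc {S : Set (Finset ℕ)} {t : List ℕ} (ha : Acc (treeRel S) t) :
    RkLE S t ha.rank := by
  induction ha with
  | intro t h ih =>
    exact RkLE.intro' fun s hs => ⟨_, Acc.rank_lt_of_rel _ hs, ih s hs⟩

def Cov (n : ℕ) (S : Set (Finset ℕ)) : Set (Finset ℕ) :=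
  {F | ∃ c : ℕ → Finset ℕ, (∀ i < n, c i ∈ S) ∧ ∀ x ∈ F, ∃ i < n, x ∈ c i}

def Hered (S : Set (Finset ℕ)) : Prop := ∀ A ∈ S, ∀ B ⊆ A, B ∈ S

def Sprd (S : Set (Finset ℕ)) : Prop :=
  ∀ (A B : Finset ℕ) (x y : ℕ), (∀ z ∈ A, z < x) → x ≤ y → (∀ z ∈ B, y < z) →
    insert x (A ∪ B) ∈ S → insert y (A ∪ B) ∈ S

def Res (S : Set (Finset ℕ)) (a : ℕ) : Set (Finset ℕ) :=
  {C | (∀ z ∈ C, a < z) ∧ insert a C ∈ S}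

theorem Res.hered {S : Set (Finset ℕ)} (h : Hered S) (a : ℕ) : Hered (Res S a) :=
  fun A hA B hB => ⟨fun z hz => hA.1 z (hB hz), h _ hA.2 _ (Finset.insert_subset_insert _ hB)⟩

theorem Res.sprd {S : Set (Finset ℕ)} (h : Sprd S) (a : ℕ) : Sprd (Res S a) := by
  intro A B x y hA hxy hB hm
  have hax : a < x := hm.1 x (by simp)
  refine ⟨?_, ?_⟩
  · intro z hz
    rcases Finset.mem_insert.1 hz with rfl | hz
    · omega
    · exact hm.1 z (Finset.mem_insert_of_mem hz)
  · have := h (insert a A) B x y (by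
      intro z hz
      rcases Finset.mem_insert.1 hz with rfl | hz
      · exact hax
      · exact hA z hz) hxy hB (by
      have := hm.2
      rwa [Finset.insert_comm, ← Finset.insert_union] at this)
    rwa [Finset.insert_union, Finset.insert_comm] at this

theorem Res.rk {S : Set (Finset ℕ)} (a : ℕ) {l : List ℕ} {δ : Ordinal.{0}} (h : RkLE S l δ) :
    ∀ v, l = a :: v → RkLE (Res S a) v δ := by
  induction h with
  | mk t δ f h1 h2 ih =>
    rintro v rfl
    have key : ∀ s, treeRel (Res S a) s v → treeRel S (a :: s) (a :: v) := by
      rintro s ⟨hc, hm, m, rfl⟩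
      refine ⟨?_, by simpa using hm.2, m, rfl⟩
      have hc' := List.isChain_iff_pairwise.1 hc
      refine List.isChain_iff_pairwise.2 (List.pairwise_cons.2 ⟨?_, hc'⟩)
      intro z hz
      exact hm.1 z (List.mem_toFinset.2 hz)
    exact RkLE.intro' fun s hs => ⟨_, h1 _ (key s hs), ih _ (key s hs) s rfl⟩

theorem comb {S : Set (Finset ℕ)} (hh : Hered S) (hs : Sprd S) {n a : ℕ} {t w : List ℕ}
    (hc : (t ++ a :: w).Pairwise (· < ·)) (hm : (t ++ a :: w).toFinset ∈ Cov (n + 1) S)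
    (hn : (t ++ [a]).toFinset ∉ Cov n S) : w.toFinset ∈ Cov (n + 1) (Res S a) := by
  obtain ⟨c, hcS, hcov⟩ := hm
  rw [List.pairwise_append, List.pairwise_cons] at hc
  obtain ⟨-, ⟨haw, -⟩, hta⟩ := hc
  refine ⟨fun i => (c i).filter (a < ·), ?_, ?_⟩
  · intro i hi
    refine ⟨by simp, ?_⟩
    have : ∃ x ∈ t ++ [a], x ∈ c i := by
      by_contra hcon
      push Not at hcon
      apply hn
      refine ⟨fun j => if j = i then c n else c j, ?_, ?_⟩
      · intro j hj
        dsimp only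
        split_ifs
        · exact hcS n (by omega)
        · exact hcS j (by omega)
      · intro x hx
        have hx := List.mem_toFinset.1 hx
        obtain ⟨j, hj, hxj⟩ := hcov x (by simp at hx ⊢; tauto)
        have hji : j ≠ i := by
          rintro rfl
          exact hcon x hx hxj
        by_cases hjn : j = n
        · subst hjn
          exact ⟨i, by omega, by simpa using hxj⟩
        · exact ⟨j, by omega, by simpa [hji] using hxj⟩
    obtain ⟨x, hx, hxc⟩ := this
    have hxa : x ≤ a := by
      rcases List.mem_append.1 hx with h | h
      · exact (hta x h a (by simp)).le
      · simp at h; omega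
    have := hs ∅ ((c i).filter (a < ·)) x a (by simp) hxa (by simp) (by
      apply hh _ (hcS i hi)
      intro z hz
      simp at hz
      rcases hz with rfl | hz
      · exact hxc
      · exact hz.1)
    simpa using this
  · intro x hx
    have hx := List.mem_toFinset.1 hx
    obtain ⟨i, hi, hxi⟩ := hcov x (by simp [hx])
    exact ⟨i, hi, by simp [hxi, haw x hx]⟩

theorem lift {S : Set (Finset ℕ)} (hh : Hered S) (hs : Sprd S) {n a : ℕ} {t : List ℕ}
    (hn : (t ++ [a]).toFinset ∉ Cov n S) {v : List ℕ} {δ : Ordinal.{0}}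
    (h : RkLE (Cov (n + 1) (Res S a)) v δ) : RkLE (Cov (n + 1) S) (t ++ a :: v) δ := by
  induction h with
  | mk v δ f h1 h2 ih =>
    apply RkLE.intro'
    rintro s ⟨hc, hm, m, rfl⟩
    have e : t ++ a :: v ++ [m] = t ++ a :: (v ++ [m]) := by simp
    rw [e] at hc hm ⊢
    have hc' := List.isChain_iff_pairwise.1 hc
    have hk : treeRel (Cov (n + 1) (Res S a)) (v ++ [m]) v := by
      refine ⟨List.isChain_iff_pairwise.2 ?_, comb hh hs hc' hm hn, m, rfl⟩
      exact (List.pairwise_cons.1 (List.pairwise_append.1 hc').2.1).2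
    exact ⟨_, h1 _ hk, ih _ hk⟩

theorem main_step (n : ℕ) (α γ : Ordinal.{0})
    (IH : ∀ S : Set (Finset ℕ), Hered S → Sprd S → RkLE S [] α → ∃ δ < γ, RkLE (Cov n S) [] δ)
    (β : Ordinal.{0}) : β ≤ α → ∀ S : Set (Finset ℕ), Hered S → Sprd S → RkLE S [] β →
      ∃ δ < γ * (β + 1), RkLE (Cov (n + 1) S) [] δ := by
  induction β using WellFoundedLT.induction with
  | ind β ihβ =>
    intro hβ S hh hs hr
    obtain ⟨δ₀, hδ₀, h₀⟩ := IH S hh hs (hr.mono hβ)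
    have claim : ∀ t δ, RkLE (Cov n S) t δ → RkLE (Cov (n + 1) S) t (γ * β + δ) := by
      intro t δ h
      induction h with
      | mk t δ f h1 h2 ih =>
        apply RkLE.intro'
        intro s hst
        by_cases hsn : s.toFinset ∈ Cov n S
        · have hk : treeRel (Cov n S) s t := ⟨hst.1, hsn, hst.2.2⟩
          exact ⟨_, by gcongr; exact h1 s hk, ih s hk⟩
        · obtain ⟨hc, hm, a, rfl⟩ := hst
          have haS : ({a} : Finset ℕ) ∈ S := by
            obtain ⟨c, hcS, hcov⟩ := hm
            obtain ⟨i, hi, hai⟩ := hcov a (by simp)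
            exact hh _ (hcS i hi) _ (by simpa using hai)
          obtain ⟨β', hβ', hr'⟩ := hr.elim' (s := [a]) ⟨List.isChain_singleton a, by simpa using haS, a, rfl⟩
          obtain ⟨ε, hε, hR⟩ := ihβ β' hβ' (hβ'.le.trans hβ) (Res S a) (Res.hered hh a)
            (Res.sprd hs a) (Res.rk a hr' [] rfl)
          refine ⟨ε, ?_, lift hh hs hsn hR⟩
          calc ε < γ * (β' + 1) := hε
            _ ≤ γ * β := by
              gcongr
              exact Order.add_one_le_of_lt hβ'
            _ ≤ γ * β + δ := le_self_add
    refine ⟨γ * β + δ₀, ?_, claim _ _ h₀⟩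
    rw [mul_add, mul_one]
    gcongr

theorem main_bound (n : ℕ) (α : Ordinal.{0}) :
    ∀ S : Set (Finset ℕ), Hered S → Sprd S → RkLE S [] α →
      ∃ δ < (α + 1) ^ n, RkLE (Cov n S) [] δ := by
  induction n with
  | zero =>
    intro S _ _ _
    refine ⟨0, by simp, RkLE.intro' ?_⟩
    rintro s ⟨_, ⟨c, _, hcov⟩, m, rfl⟩
    obtain ⟨i, hi, _⟩ := hcov m (by simp)
    omega
  | succ n ih =>
    intro S hh hs hr
    rw [pow_succ]
    exact main_step n α _ ih α le_rfl S hh hs hr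

theorem sort_eq (A B : Finset ℕ) (x : ℕ) (hA : ∀ z ∈ A, z < x) (hB : ∀ z ∈ B, x < z) :
    (insert x (A ∪ B)).sort (· ≤ ·) = A.sort (· ≤ ·) ++ x :: B.sort (· ≤ ·) := by
  have e : insert x (A ∪ B) = (A.sort (· ≤ ·) ++ x :: B.sort (· ≤ ·)).toFinset := by
    ext z; simp
  have hp : (A.sort (· ≤ ·) ++ x :: B.sort (· ≤ ·)).Pairwise (· < ·) := by
    rw [List.pairwise_append, List.pairwise_cons]
    refine ⟨(Finset.sortedLT_sort A).pairwise, ⟨by simpa using hB, (Finset.sortedLT_sort B).pairwise⟩, ?_⟩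
    intro z hz w hw
    have hz := hA z (by simpa using hz)
    simp at hw
    rcases hw with rfl | hw
    · exact hz
    · exact hz.trans (hB w hw)
  rw [e]
  exact (List.toFinset_sort (· ≤ ·) (hp.imp fun h => h.ne)).2 (hp.imp fun h => h.le)

theorem IsAdmissibleFamily.sprd {S : Set (Finset ℕ)} (hS : IsAdmissibleFamily S) : Sprd S := by
  intro A B x y hA hxy hB hm
  apply hS.spreading _ hm
  unfold SpreadLE
  rw [sort_eq A B x hA (fun z hz => hxy.trans_lt (hB z hz)),
    sort_eq A B y (fun z hz => (hA z hz).trans_le hxy) hB]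
  exact List.rel_append (List.forall₂_refl _) (List.Forall₂.cons hxy (List.forall₂_refl _))

theorem ball_subset {S : Set (Finset ℕ)} (hS : IsAdmissibleFamily S) (n : ℕ) :
    {F : Finset ℕ | normOf S F ≤ n} ⊆ Cov n S := by
  intro F hF
  have hne : {n | ∃ c : Finset (Finset ℕ), ↑c ⊆ S ∧ c.card = n ∧ F ⊆ c.biUnion id}.Nonempty := by
    refine ⟨_, F.image (fun x => {x}), ?_, rfl, ?_⟩
    · intro A hA
      simp at hA
      obtain ⟨x, _, rfl⟩ := hA
      exact hS.singletons x
    · intro x hx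
      simpa using hx
  obtain ⟨c, hcS, hcard, hcov⟩ := Nat.sInf_mem hne
  have hF' : c.card ≤ n := hcard.trans_le hF
  have h0 : (∅ : Finset ℕ) ∈ S := hS.hereditary _ (hS.singletons 0) _ (by simp)
  refine ⟨fun i => c.toList.getD i ∅, ?_, ?_⟩
  · intro i _
    by_cases hi : i < c.toList.length
    · simp only [List.getD_eq_getElem _ _ hi]
      exact hcS (by
        have := List.getElem_mem hi
        exact Finset.mem_toList.1 this)
    · simp only [List.getD_eq_default _ _ (not_lt.1 hi)]
      exact h0
  · intro x hx
    obtain ⟨A, hA, hxA⟩ := Finset.mem_biUnion.1 (hcov hx)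
    obtain ⟨i, hi, rfl⟩ := List.getElem_of_mem (Finset.mem_toList.2 hA)
    refine ⟨i, ?_, ?_⟩
    · rw [Finset.length_toList] at hi; omega
    · simp only [List.getD_eq_getElem _ _ hi]
      exact hxA

/-- If `𝒮` is an admissible family with `ρ(𝒮) = α`, `‖·‖_𝒮` is the derived covering
norm and `𝒮ⁿ = {F : ‖F‖_𝒮 ≤ n}` for an integer `n > 0`, then `ρ(𝒮ⁿ) < (α+1)ⁿ`. -/
theorem rho_normBall_lt (S : Set (Finset ℕ)) (hS : IsAdmissibleFamily S)
    (α : Ordinal) (hα : rho S = α) (n : ℕ) (hn : 0 < n) :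
    rho {F : Finset ℕ | normOf S F ≤ n} < (α + 1) ^ n := by
  have hpos : (0 : Ordinal) < (α + 1) ^ n := by
    apply pow_pos
    exact lt_of_lt_of_le zero_lt_one le_add_self
  by_cases hw2 : WellFounded (treeRel {F : Finset ℕ | normOf S F ≤ n})
  · have hsub : S ⊆ {F : Finset ℕ | normOf S F ≤ n} := by
      intro A hA
      have h1 : normOf S A ≤ 1 := by
        apply Nat.sInf_le
        exact ⟨{A}, by simpa using hA, Finset.card_singleton A, by simp⟩
      exact h1.trans hn
    have hw : WellFounded (treeRel S) :=
      Subrelation.wf (fun {s t} h => ⟨h.1, hsub h.2.1, h.2.2⟩) hw2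
    have hr : RkLE S [] α := by
      rw [← hα, rho, dif_pos hw]
      exact RkLE.of_acc _
    obtain ⟨δ, hδ, h⟩ := main_bound n α S hS.hereditary hS.sprd hr
    rw [rho, dif_pos hw2]
    exact ((h.of_subset (ball_subset hS n)).rank_le _).trans_lt hδ
  · rw [rho, dif_neg hw2]
    exact hpos
end

section
/- There exists a sequence (<_n)_{n∈ℕ} of partial orders on ω₁ such that: (1) if n < m and ξ <_n η then ξ <_m η; (2) each (ω₁, <_n) is a tree of finite height, i.e. the set of <_n-predecessors of any element is linearly ordered by <_n and there is a finite bound on the lengths of <_n-chains; (3) the usual strict order on ω₁ is the union of the relations <_n. -/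
open Ordinal Filter
open scoped ENNReal

/-- `ω₁`, viewed as the set of countable ordinals. -/
abbrev Omega1 := {o : Ordinal // o < Ordinal.omega 1}

section GalvinAux

open Classical

variable {T : Type*} [LinearOrder T]

/-- `C` is a good column at `b` relative to the earlier columns `G`. -/
structure GoodCol (b : T) (G : T → ℕ → Finset T) (C : ℕ → Finset T) : Prop where
  lt : ∀ n, ∀ x ∈ C n, x < b
  mono : ∀ n m, n ≤ m → C n ⊆ C m
  exh : ∀ x, x < b → ∃ n, x ∈ C n
  coh : ∀ n, ∀ a ∈ C n, ∀ x, x ∈ G a n ↔ x ∈ C n ∧ x < a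
  card : ∀ n, (C n).card ≤ n
  slack : ∀ k, ∃ N, ∀ n, N ≤ n → (C n).card + k ≤ n

theorem GoodCol.congr {b : T} {G G' : T → ℕ → Finset T} {C : ℕ → Finset T}
    (h : GoodCol b G C) (hG : ∀ a < b, G a = G' a) : GoodCol b G' C where
  lt := h.lt
  mono := h.mono
  exh := h.exh
  coh := fun n a ha x => by rw [← hG a (h.lt n a ha)]; exact h.coh n a ha x
  card := h.card
  slack := h.slack

theorem exists_goodCol (b : T) (hb : (Set.Iio b).Countable) (G : T → ℕ → Finset T)
    (hG : ∀ a < b, GoodCol a G (G a)) : ∃ C, GoodCol b G C := by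
  by_cases hne : (Set.Iio b).Nonempty
  swap
  · refine ⟨fun _ => ∅, ⟨by simp, by simp, ?_, by simp, by simp, fun k => ⟨k, by simp⟩⟩⟩
    intro x hx
    exact absurd ⟨x, hx⟩ hne
  obtain ⟨e, he⟩ := hb.exists_eq_range hne
  have heb : ∀ k, e k < b := fun k => by
    have : e k ∈ Set.Iio b := by rw [he]; exact ⟨k, rfl⟩
    exact this
  obtain ⟨s, hs_mono, hs_ge, hs_lt⟩ : ∃ s : ℕ → T, Monotone s ∧ (∀ k, e k ≤ s k) ∧
      ∀ k, s k < b := by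
    refine ⟨fun k => partialSups e k, (partialSups e).monotone, fun k => le_partialSups e k, ?_⟩
    intro k
    induction k with
    | zero => simpa using heb 0
    | succ k ih => 
      simp only [partialSups_add_one] at ih ⊢
      exact max_lt ih (heb _)
  have hev : ∀ k, ∀ᶠ m in atTop, ∀ n, m ≤ n →
      ((s k = s (k+1) ∨ s k ∈ G (s (k+1)) n) ∧ (G (s k) n).card + 1 + k ≤ n) := by
    intro k
    obtain ⟨N, hN⟩ := (hG _ (hs_lt k)).slack (1 + k)
    obtain ⟨M, hM⟩ : ∃ M, ∀ n, M ≤ n → (s k = s (k+1) ∨ s k ∈ G (s (k+1)) n) := by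
      rcases (hs_mono (Nat.le_succ k)).eq_or_lt with h | h
      · exact ⟨0, fun _ _ => Or.inl h⟩
      · obtain ⟨M, hM⟩ := (hG _ (hs_lt (k+1))).exh _ h
        exact ⟨M, fun n hn => Or.inr ((hG _ (hs_lt (k+1))).mono M n hn hM)⟩
    filter_upwards [eventually_ge_atTop (max N M)] with m hm n hn
    refine ⟨hM n (by omega), ?_⟩
    have := hN n (by omega)
    omega
  obtain ⟨N, hNm, hN⟩ := extraction_forall_of_eventually hev
  have hNk : ∀ k, k ≤ N k := hNm.id_le
  -- the block at `k`
  let B : ℕ → ℕ → Finset T := fun k n => insert (s k) (G (s k) n)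
  have hBmem : ∀ k n x, x ∈ B k n ↔ x = s k ∨ x ∈ G (s k) n := fun k n x => Finset.mem_insert
  have hBmono : ∀ k n m, n ≤ m → B k n ⊆ B k m := fun k n m h =>
    Finset.insert_subset_insert _ ((hG _ (hs_lt k)).mono n m h)
  have hBstep : ∀ k n, N k ≤ n → B k n ⊆ B (k+1) n := by
    intro k n hn x hx
    rw [hBmem] at hx ⊢
    rcases (hN k n hn).1 with h | h
    · rwa [← h]
    · right
      rcases hx with rfl | hx
      · exact h
      · exact (((hG _ (hs_lt (k+1))).coh n _ h x).1 hx).1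
  have hBle : ∀ n j k, j ≤ k → N k ≤ n → B j n ⊆ B k n := by
    intro n j k hjk
    induction k, hjk using Nat.le_induction with
    | base => intro _; exact Finset.Subset.refl _
    | succ k hk ih =>
      intro h
      have h' : N k ≤ n := (hNm.monotone (Nat.le_succ k)).trans h
      exact (ih h').trans (hBstep k n h')
  let C : ℕ → Finset T := fun n => ((Finset.range (n+1)).filter (fun k => N k ≤ n)).biUnion
    (fun k => B k n)
  have hC : ∀ n x, x ∈ C n ↔ ∃ k, N k ≤ n ∧ x ∈ B k n := by
    intro n x
    simp only [C, Finset.mem_biUnion, Finset.mem_filter, Finset.mem_range]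
    constructor
    · rintro ⟨k, ⟨_, h⟩, hx⟩; exact ⟨k, h, hx⟩
    · rintro ⟨k, h, hx⟩
      exact ⟨k, ⟨by have := hNk k; omega, h⟩, hx⟩
  have hcard : ∀ K n, N K ≤ n → (C n).card + K ≤ n := by
    intro K n hK
    have hKn : K ≤ n := (hNk K).trans hK
    have h1 : N (Nat.findGreatest (fun k => N k ≤ n) n) ≤ n :=
      Nat.findGreatest_spec (P := fun k => N k ≤ n) hKn hK
    have h2 : K ≤ Nat.findGreatest (fun k => N k ≤ n) n :=
      Nat.le_findGreatest (P := fun k => N k ≤ n) hKn hK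
    have h3 : ∀ j, N j ≤ n → j ≤ Nat.findGreatest (fun k => N k ≤ n) n := fun j hj =>
      Nat.le_findGreatest (P := fun k => N k ≤ n) ((hNk j).trans hj) hj
    generalize Nat.findGreatest (fun k => N k ≤ n) n = k at h1 h2 h3
    have hsub : C n ⊆ B k n := by
      intro x hx
      obtain ⟨j, hj, hx⟩ := (hC n x).1 hx
      exact hBle n j k (h3 j hj) h1 hx
    have c1 := Finset.card_le_card hsub
    have c2 : (B k n).card ≤ (G (s k) n).card + 1 := Finset.card_insert_le _ _
    have c3 := (hN k n h1).2
    omega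
  refine ⟨C, ⟨?_, ?_, ?_, ?_, ?_, fun K => ⟨N K, hcard K⟩⟩⟩
  · intro n x hx
    obtain ⟨k, _, hx⟩ := (hC n x).1 hx
    rcases (hBmem _ _ _).1 hx with rfl | hx
    · exact hs_lt k
    · exact ((hG _ (hs_lt k)).lt n x hx).trans (hs_lt k)
  · intro n m hnm x hx
    obtain ⟨k, hk, hx⟩ := (hC n x).1 hx
    exact (hC m x).2 ⟨k, hk.trans hnm, hBmono k n m hnm hx⟩
  · intro x hx
    have : x ∈ Set.range e := by rw [← he]; exact hx
    obtain ⟨j, rfl⟩ := this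
    rcases (hs_ge j).eq_or_lt with h | h
    · exact ⟨N j, (hC _ _).2 ⟨j, le_rfl, (hBmem _ _ _).2 (Or.inl h)⟩⟩
    · obtain ⟨m, hm⟩ := (hG _ (hs_lt j)).exh _ h
      refine ⟨max m (N j), (hC _ _).2 ⟨j, le_max_right _ _, (hBmem _ _ _).2 (Or.inr ?_)⟩⟩
      exact (hG _ (hs_lt j)).mono _ _ (le_max_left _ _) hm
  · intro n a ha x
    obtain ⟨k, hk, ha⟩ := (hC n a).1 ha
    constructor
    · intro hx
      rcases (hBmem _ _ _).1 ha with rfl | ha'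
      · exact ⟨(hC _ _).2 ⟨k, hk, (hBmem _ _ _).2 (Or.inr hx)⟩, (hG _ (hs_lt k)).lt n x hx⟩
      · have := ((hG _ (hs_lt k)).coh n a ha' x).1 hx
        exact ⟨(hC _ _).2 ⟨k, hk, (hBmem _ _ _).2 (Or.inr this.1)⟩, this.2⟩
    · rintro ⟨hx, hxa⟩
      obtain ⟨j, hj, hx⟩ := (hC n x).1 hx
      obtain ⟨i, hx, ha⟩ : ∃ i, x ∈ B i n ∧ a ∈ B i n := by
        rcases le_total j k with h | h
        · exact ⟨k, hBle n j k h hk hx, ha⟩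
        · exact ⟨j, hx, hBle n k j h hj ha⟩
      rcases (hBmem _ _ _).1 ha with rfl | ha'
      · rcases (hBmem _ _ _).1 hx with rfl | hx'
        · exact absurd hxa (lt_irrefl _)
        · exact hx'
      · refine ((hG _ (hs_lt i)).coh n a ha' x).2 ⟨?_, hxa⟩
        rcases (hBmem _ _ _).1 hx with rfl | hx'
        · exact absurd (hxa.trans ((hG _ (hs_lt i)).lt n a ha')) (lt_irrefl _)
        · exact hx'
  · intro n
    by_cases h : N 0 ≤ n
    · simpa using hcard 0 n h
    · have : C n = ∅ := by
        rw [Finset.eq_empty_iff_forall_notMem]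
        intro x hx
        obtain ⟨k, hk, _⟩ := (hC n x).1 hx
        exact h ((hNm.monotone (Nat.zero_le k)).trans hk)
      simp [this]

theorem exists_goodFamily [WellFoundedLT T] (hT : ∀ b : T, (Set.Iio b).Countable) :
    ∃ F : T → ℕ → Finset T, ∀ b, GoodCol b F (F b) := by
  let ext : (b : T) → ((a : T) → a < b → ℕ → Finset T) → T → ℕ → Finset T :=
    fun b prev a => if h : a < b then prev a h else fun _ => ∅
  let step : (b : T) → ((a : T) → a < b → ℕ → Finset T) → ℕ → Finset T :=
    fun b prev => if h : ∃ C, GoodCol b (ext b prev) C then h.choose else fun _ => ∅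
  have wf : WellFounded (fun a b : T => a < b) := wellFounded_lt
  let F : T → ℕ → Finset T := wf.fix step
  have hF : ∀ b, F b = step b (fun a _ => F a) := fun b => wf.fix_eq step b
  refine ⟨F, fun b => ?_⟩
  induction b using wf.induction with
  | _ b ih =>
    have hext : ∀ a < b, F a = ext b (fun a _ => F a) a := fun a ha => by simp [ext, ha]
    have hex : ∃ C, GoodCol b (ext b (fun a _ => F a)) C := by
      obtain ⟨C, hC⟩ := exists_goodCol b (hT b) F ih
      exact ⟨C, hC.congr hext⟩
    have : F b = hex.choose := by
      rw [hF b]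
      exact dif_pos hex
    rw [this]
    exact hex.choose_spec.congr (fun a ha => (hext a ha).symm)

end GalvinAux

theorem omega1_Iio_countable (b : Omega1) : (Set.Iio b).Countable := by
  have h : (Set.Iio b.1).Countable := by
    rw [← Cardinal.le_aleph0_iff_set_countable, Ordinal.mk_Iio_ordinal,
      Cardinal.lift_le_aleph0]
    have := b.2
    rw [← Order.lt_succ_iff, Cardinal.succ_aleph0, ← Cardinal.lt_ord, Cardinal.ord_aleph]
    exact this
  exact (h.preimage Subtype.val_injective)

/-- Galvin's lemma: there is a sequence `(<ₙ)` of strict partial orders on `ω₁` such that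
`<ₙ ⊆ <ₘ` for `n < m`, each `(ω₁, <ₙ)` is a tree of finite height, and the usual strict
order on `ω₁` is the union of the `<ₙ`. -/
theorem galvin_decomposition :
    ∃ r : ℕ → Omega1 → Omega1 → Prop,
      (∀ (n : ℕ) (a : Omega1), ¬ r n a a) ∧
      (∀ (n : ℕ) (a b c : Omega1), r n a b → r n b c → r n a c) ∧
      (∀ n m : ℕ, n < m → ∀ ξ η : Omega1, r n ξ η → r m ξ η) ∧
      (∀ (n : ℕ) (a b c : Omega1), r n b a → r n c a → r n b c ∨ r n c b ∨ b = c) ∧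
      (∀ n : ℕ, ∃ k : ℕ, ∀ l : List Omega1, l.Chain' (r n) → l.length ≤ k) ∧
      (∀ ξ η : Omega1, ξ < η ↔ ∃ n, r n ξ η) := by
  obtain ⟨F, hF⟩ := exists_goodFamily omega1_Iio_countable
  refine ⟨fun n a b => a ∈ F b n, ?_, ?_, ?_, ?_, ?_, ?_⟩
  · intro n a h
    exact lt_irrefl _ ((hF a).lt n a h)
  · intro n a b c hab hbc
    exact (((hF c).coh n b hbc a).1 hab).1
  · intro n m hnm a b h
    exact (hF b).mono n m hnm.le h
  · intro n a b c hb hc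
    rcases lt_trichotomy b c with h | h | h
    · exact Or.inl (((hF a).coh n c hc b).2 ⟨hb, h⟩)
    · exact Or.inr (Or.inr h)
    · exact Or.inr (Or.inl (((hF a).coh n b hb c).2 ⟨hc, h⟩))
  · intro n
    have hlt : ∀ a b, a ∈ F b n → (F a n).card < (F b n).card := by
      intro a b h
      apply Finset.card_lt_card
      rw [Finset.ssubset_iff_of_subset (fun x hx => (((hF b).coh n a h x).1 hx).1)]
      exact ⟨a, h, fun h' => lt_irrefl _ ((hF a).lt n a h')⟩
    have key : ∀ (l : List Omega1) (a : Omega1), (a :: l).IsChain (fun a b => a ∈ F b n) →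
        l.length + (F a n).card ≤ n := by
      intro l
      induction l with
      | nil => intro a _; simpa using (hF a).card n
      | cons b l ih =>
        intro a h
        rw [List.isChain_cons_cons] at h
        have h1 := ih b h.2
        have h2 := hlt a b h.1
        simp only [List.length_cons]
        omega
    refine ⟨n + 1, fun l hl => ?_⟩
    cases l with
    | nil => simp
    | cons a l =>
      have := key l a hl
      simp only [List.length_cons]
      omega
  · intro a b
    exact ⟨fun h => (hF b).exh a h, fun ⟨n, h⟩ => (hF b).lt n a h⟩
end

section
/- Fix a Galvin decomposition (<_n) of ω₁ that moreover satisfies 0 <_n ξ for all 0 < ξ < ω₁ and all n. Then for every countable ordinal α > 0 the Schreier family 𝒮_α is admissible, i.e. compact, hereditary, spreading, and contains all singletons. -/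
open Ordinal Filter
open scoped ENNReal
/-- A Galvin decomposition of `ω₁`: a sequence of strict partial orders `r n` on `ω₁`,
increasing in `n`, each a tree of finite height, whose union is the usual strict order. -/
structure IsGalvin (r : ℕ → Omega1 → Omega1 → Prop) : Prop where
  irrefl : ∀ (n : ℕ) (a : Omega1), ¬ r n a a
  trans : ∀ (n : ℕ) (a b c : Omega1), r n a b → r n b c → r n a c
  mono : ∀ n m : ℕ, n < m → ∀ ξ η : Omega1, r n ξ η → r m ξ η
  tree : ∀ (n : ℕ) (a b c : Omega1), r n b a → r n c a → r n b c ∨ r n c b ∨ b = c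
  finHeight : ∀ n : ℕ, ∃ k : ℕ, ∀ l : List Omega1, l.Chain' (r n) → l.length ≤ k
  union : ∀ ξ η : Omega1, ξ < η ↔ ∃ n, r n ξ η

/-- `SchreierList r a l` holds iff, reading the increasing list `l = [n₀, …, n_{k-1}]`,
there are ordinals `a = α₀, α₁, …, α_k` with `α_{i+1} <_{n_i} α_i`. -/
def SchreierList (r : ℕ → Omega1 → Omega1 → Prop) : Omega1 → List ℕ → Prop
  | _, [] => True
  | a, n :: l => ∃ b, r n b a ∧ SchreierList r b l

/-- The Schreier family `𝒮_α` determined by the Galvin decomposition `r`. -/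
def Schreier (r : ℕ → Omega1 → Omega1 → Prop) (α : Omega1) : Set (Finset ℕ) :=
  {F | SchreierList r α (F.sort (· ≤ ·))}
theorem aux_lift {r : ℕ → Omega1 → Omega1 → Prop} (hr : IsGalvin r) {n : ℕ} {a b : Omega1}
    (h : r n b a) : ∀ l : List ℕ, (∀ m ∈ l, n < m) → SchreierList r b l → SchreierList r a l
  | [], _, _ => trivial
  | m :: l, hl, ⟨c, hc, hs⟩ =>
    ⟨c, hr.trans m c b a hc (hr.mono n m (hl m (by simp)) b a h), hs⟩

theorem aux_sub {r : ℕ → Omega1 → Omega1 → Prop} (hr : IsGalvin r) {l l' : List ℕ}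
    (h : l'.Sublist l) : l.Pairwise (· < ·) → ∀ a, SchreierList r a l → SchreierList r a l' := by
  induction h with
  | slnil => intro _ a h; exact h
  | cons x h ih =>
    intro hp a ⟨b, hb, hs⟩
    rw [List.pairwise_cons] at hp
    exact aux_lift hr hb _ (fun m hm => hp.1 m (h.subset hm)) (ih hp.2 b hs)
  | cons_cons x h ih =>
    intro hp a ⟨b, hb, hs⟩
    rw [List.pairwise_cons] at hp
    exact ⟨b, hb, ih hp.2 b hs⟩

theorem aux_spread {r : ℕ → Omega1 → Omega1 → Prop} (hr : IsGalvin r) {l l' : List ℕ}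
    (h : List.Forall₂ (· ≤ ·) l l') : ∀ a, SchreierList r a l → SchreierList r a l' := by
  induction h with
  | nil => intro a h; exact h
  | cons hx _ ih =>
    intro a ⟨b, hb, hs⟩
    refine ⟨b, ?_, ih b hs⟩
    rcases hx.lt_or_eq with h | h
    · exact hr.mono _ _ h _ _ hb
    · exact h ▸ hb

theorem aux_hered {r : ℕ → Omega1 → Omega1 → Prop} (hr : IsGalvin r) (a : Omega1)
    {A B : Finset ℕ} (hA : A ∈ Schreier r a) (h : B ⊆ A) : B ∈ Schreier r a := by
  refine aux_sub hr ?_ (Finset.sortedLT_sort A).pairwise a hA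
  refine List.sublist_of_subperm_of_pairwise (r := (· ≤ ·)) ?_ (Finset.pairwise_sort _ _)
    (Finset.pairwise_sort _ _)
  refine List.subperm_of_subset (Finset.sort_nodup _ _) ?_
  intro x hx
  simpa using h (by simpa using hx)

theorem aux_fin {r : ℕ → Omega1 → Omega1 → Prop} (hr : IsGalvin r) (n : ℕ) (a : Omega1) :
    {b | r n b a}.Finite := by
  by_contra hinf
  obtain ⟨k, hk⟩ := hr.finHeight n
  obtain ⟨t, ht, hc⟩ := Set.Infinite.exists_subset_card_eq hinf (k + 1)
  have h := hk (t.sort (· ≤ ·)) (by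
    apply List.Pairwise.isChain
    refine (Finset.sortedLT_sort t).pairwise.imp_of_mem ?_
    intro b c hb hc hbc
    have hb' : r n b a := ht (by simpa using hb)
    have hc' : r n c a := ht (by simpa using hc)
    rcases hr.tree n a b c hb' hc' with h | h | h
    · exact h
    · exact absurd ((hr.union c b).2 ⟨n, h⟩) hbc.asymm
    · exact absurd h hbc.ne)
  rw [Finset.length_sort] at h
  omega

theorem aux_pre {r : ℕ → Omega1 → Omega1 → Prop} {l l' : List ℕ} (h : l' <+: l) :
    ∀ a, SchreierList r a l → SchreierList r a l' := by
  obtain ⟨m, rfl⟩ := h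
  induction l' with
  | nil => intro a _; trivial
  | cons x l' ih => intro a ⟨b, hb, hs⟩; exact ⟨b, hb, ih b hs⟩

theorem aux_wf_s3 {r : ℕ → Omega1 → Omega1 → Prop} (hr : IsGalvin r) (a : Omega1) :
    ∀ s : ℕ → ℕ, ∃ k, ¬ SchreierList r a ((List.range k).map s) := by
  induction a using WellFoundedLT.induction with
  | ind a ih =>
    intro s
    have h1 : ∀ b, ∃ k, r (s 0) b a → ¬ SchreierList r b ((List.range k).map (fun i => s (i+1))) := by
      intro b
      by_cases hb : r (s 0) b a
      · obtain ⟨k, hk⟩ := ih b ((hr.union b a).2 ⟨_, hb⟩) (fun i => s (i+1))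
        exact ⟨k, fun _ => hk⟩
      · exact ⟨0, fun h => absurd h hb⟩
    choose k hk using h1
    obtain ⟨K, hK⟩ := ((aux_fin hr (s 0) a).image k).bddAbove
    refine ⟨K + 1, ?_⟩
    rw [List.range_succ_eq_map]
    rintro ⟨b, hb, hs⟩
    refine hk b hb (aux_pre ?_ b hs)
    have hle : k b ≤ K := hK ⟨b, hb, rfl⟩
    rw [List.map_map]
    refine List.IsPrefix.map _ ?_
    obtain ⟨d, rfl⟩ := Nat.exists_eq_add_of_le hle
    rw [List.range_add]
    exact List.prefix_append _ _

/-- For any Galvin decomposition `(<ₙ)` of `ω₁` with `0 <ₙ ξ` for all `0 < ξ < ω₁` and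
all `n`, the Schreier family `𝒮_α` is admissible for every countable ordinal `α > 0`. -/
theorem schreier_isAdmissibleFamily (r : ℕ → Omega1 → Omega1 → Prop) (hr : IsGalvin r)
    (h0 : ∀ (n : ℕ) (z ξ : Omega1), z.1 = 0 → 0 < ξ.1 → r n z ξ)
    (α : Omega1) (hα : 0 < α.1) :
    IsAdmissibleFamily (Schreier r α) := by
  refine ⟨?_, fun A hA B hB => aux_hered hr α hA hB, fun A hA B hB => aux_spread hr hB α hA, ?_⟩
  · apply IsClosed.isCompact
    apply isClosed_of_closure_subset
    intro f hf
    have key : ∀ T : Finset ℕ, (∀ n ∈ T, f n = true) → T ∈ Schreier r α := by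
      intro T hT
      rw [mem_closure_iff] at hf
      obtain ⟨g, hg, A, hA, rfl⟩ := hf ((T : Set ℕ).pi (fun n => {f n}))
        (isOpen_set_pi T.finite_toSet (fun n _ => isOpen_discrete _)) (fun n _ => rfl)
      refine aux_hered hr α hA ?_
      intro n hn
      have := hg n hn
      simpa [hT n hn] using this
    by_cases hfin : {n | f n = true}.Finite
    · refine ⟨hfin.toFinset, key _ (by simp), ?_⟩
      funext n
      simp
    · exfalso
      obtain ⟨k, hk⟩ := aux_wf_s3 hr α (Nat.nth (fun n => f n = true))
      have hmono := Nat.nth_strictMono (p := fun n => f n = true) hfin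
      apply hk
      have h := key ((Finset.range k).image (Nat.nth (fun n => f n = true))) (by
        intro n hn
        obtain ⟨i, _, rfl⟩ := Finset.mem_image.1 hn
        exact Nat.nth_mem_of_infinite (p := fun n => f n = true) hfin i)
      have hs : ((Finset.range k).image (Nat.nth (fun n => f n = true))).sort (· ≤ ·)
          = (List.range k).map (Nat.nth (fun n => f n = true)) := by
        have hp : ((List.range k).map (Nat.nth (fun n => f n = true))).Pairwise (· < ·) :=
          List.pairwise_map.2 (List.pairwise_lt_range.imp (fun h => hmono h))
        refine List.Perm.eq_of_pairwise (le := (· ≤ ·)) (fun a b _ _ h1 h2 => le_antisymm h1 h2)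
          (Finset.pairwise_sort _ _) (hp.imp le_of_lt) ?_
        refine (List.perm_ext_iff_of_nodup (Finset.sort_nodup _ _) (hp.imp ne_of_lt)).2 ?_
        intro x
        simp
      unfold Schreier at h
      rw [Set.mem_setOf_eq, hs] at h
      exact h
  · intro n
    unfold Schreier
    rw [Set.mem_setOf_eq, Finset.sort_singleton]
    exact ⟨⟨0, hα.trans α.2⟩, h0 n _ _ rfl hα, trivial⟩
end

section
/- Fix a Galvin decomposition (<_n) of ω₁ that satisfies 0 <_n ξ for all 0 < ξ < ω₁ and all n. Then ρ(𝒮_α) = α for every countable ordinal α > 0. -/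
open Ordinal Filter
open scoped ENNReal
theorem galvin_max {r : ℕ → Omega1 → Omega1 → Prop} (hr : IsGalvin r) (n : ℕ) (a : Omega1)
    (h : ∃ b, r n b a) : ∃ p, r n p a ∧ ∀ b, r n b a → b = p ∨ r n b p := by
  by_contra hc
  push Not at hc
  have step : ∀ p, r n p a → ∃ b, r n b a ∧ r n p b := by
    intro p hp
    obtain ⟨b, hb, hne, hnr⟩ := hc p hp
    refine ⟨b, hb, ?_⟩
    rcases hr.tree n a b p hb hp with h1 | h1 | h1
    · exact absurd h1 hnr
    · exact h1
    · exact absurd h1 hne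
  have key : ∀ k : ℕ, ∃ l : List Omega1, ∃ b, r n b a ∧ List.IsChain (r n) (l ++ [b]) ∧
      l.length = k := by
    intro k
    induction k with
    | zero =>
      obtain ⟨b, hb⟩ := h
      exact ⟨[], b, hb, by simp, rfl⟩
    | succ k ih =>
      obtain ⟨l, b, hb, hl, hk⟩ := ih
      obtain ⟨c, hc1, hc2⟩ := step b hb
      refine ⟨l ++ [b], c, hc1, ?_, by simp [hk]⟩
      rw [List.isChain_append]
      refine ⟨hl, by simp, ?_⟩
      simp [hc2]
  obtain ⟨k, hk⟩ := hr.finHeight n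
  obtain ⟨l, b, _, hl, hlen⟩ := key k
  have := hk _ hl
  simp at this
  omega

open Classical in
noncomputable def galvinPred (r : ℕ → Omega1 → Omega1 → Prop) (n : ℕ) (a : Omega1) : Omega1 :=
  if h : ∃ p, r n p a ∧ ∀ b, r n b a → b = p ∨ r n b p then h.choose else a

theorem galvinPred_spec {r : ℕ → Omega1 → Omega1 → Prop} (hr : IsGalvin r) {n : ℕ} {a b : Omega1}
    (h : r n b a) : r n (galvinPred r n a) a ∧ (b = galvinPred r n a ∨ r n b (galvinPred r n a)) := by
  have h' := galvin_max hr n a ⟨b, h⟩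
  unfold galvinPred
  rw [dif_pos h']
  exact ⟨h'.choose_spec.1, h'.choose_spec.2 b h⟩

noncomputable def galvinEnd (r : ℕ → Omega1 → Omega1 → Prop) (a : Omega1) (l : List ℕ) : Omega1 :=
  l.foldl (fun a n => galvinPred r n a) a

theorem schreierList_greedy {r : ℕ → Omega1 → Omega1 → Prop} (hr : IsGalvin r) {a : Omega1}
    {n : ℕ} {l : List ℕ} (hl : ∀ m ∈ l, n < m) (h : SchreierList r a (n :: l)) :
    r n (galvinPred r n a) a ∧ SchreierList r (galvinPred r n a) l := by
  obtain ⟨b, hb, hbl⟩ := h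
  obtain ⟨h1, h2⟩ := galvinPred_spec hr hb
  refine ⟨h1, ?_⟩
  rcases h2 with h2 | h2
  · rw [← h2]; exact hbl
  · cases l with
    | nil => trivial
    | cons m l =>
      obtain ⟨c, hc, hcl⟩ := hbl
      exact ⟨c, hr.trans m _ _ _ hc (hr.mono n m (hl m (by simp)) _ _ h2), hcl⟩

theorem galvinEnd_step {r : ℕ → Omega1 → Omega1 → Prop} (hr : IsGalvin r) (n : ℕ) (l : List ℕ) :
    ∀ a : Omega1, (l ++ [n]).Pairwise (· < ·) → SchreierList r a (l ++ [n]) →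
      r n (galvinEnd r a (l ++ [n])) (galvinEnd r a l) := by
  induction l with
  | nil =>
    intro a _ h
    obtain ⟨b, hb, _⟩ := h
    exact (galvinPred_spec hr hb).1
  | cons m l ih =>
    intro a hs h
    rw [List.cons_append, List.pairwise_cons] at hs
    exact ih _ hs.2 (schreierList_greedy hr hs.1 h).2

theorem schreierList_append {r : ℕ → Omega1 → Omega1 → Prop} (hr : IsGalvin r) (k l : List ℕ) :
    ∀ a : Omega1, l.Pairwise (· < ·) → SchreierList r a l →
      SchreierList r (galvinEnd r a l) k → SchreierList r a (l ++ k) := by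
  induction l with
  | nil => intro a _ _ h; exact h
  | cons m l ih =>
    intro a hs h hk
    rw [List.pairwise_cons] at hs
    obtain ⟨h1, h2⟩ := schreierList_greedy hr hs.1 h
    exact ⟨_, h1, ih _ hs.2 h2 hk⟩

theorem treeRel_schreier (r : ℕ → Omega1 → Omega1 → Prop) (α : Omega1) (s t : List ℕ) :
    treeRel (Schreier r α) s t ↔
      s.Pairwise (· < ·) ∧ SchreierList r α s ∧ ∃ n, s = t ++ [n] := by
  unfold treeRel Schreier
  have : s.Chain' (· < ·) ↔ s.Pairwise (· < ·) := List.isChain_iff_pairwise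
  rw [this]
  refine and_congr_right fun hs => ?_
  have h2 : s.toFinset.sort (· ≤ ·) = s :=
    (List.toFinset_sort (· ≤ ·) (hs.imp fun h => ne_of_lt h)).2 (hs.imp fun h => le_of_lt h)
  rw [Set.mem_setOf_eq, h2]

/-- For any Galvin decomposition `(<ₙ)` of `ω₁` with `0 <ₙ ξ` for all `0 < ξ < ω₁` and
all `n`, we have `ρ(𝒮_α) = α` for every countable ordinal `α > 0`. -/
theorem rho_schreier (r : ℕ → Omega1 → Omega1 → Prop) (hr : IsGalvin r)
    (h0 : ∀ (n : ℕ) (z ξ : Omega1), z.1 = 0 → 0 < ξ.1 → r n z ξ)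
    (α : Omega1) (hα : 0 < α.1) :
    rho (Schreier r α) = α.1 := by
  have hdec : ∀ s t, treeRel (Schreier r α) s t → galvinEnd r α s < galvinEnd r α t := by
    intro s t h
    rw [treeRel_schreier] at h
    obtain ⟨hs, hS, n, rfl⟩ := h
    exact (hr.union _ _).2 ⟨n, galvinEnd_step hr n t α hs hS⟩
  have hwf : WellFounded (treeRel (Schreier r α)) :=
    Subrelation.wf (fun {s t} h => hdec s t h)
      (InvImage.wf (galvinEnd r α) (wellFounded_lt (α := Omega1)))
  have hup : ∀ l, (hwf.apply l).rank ≤ (galvinEnd r α l).1 := by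
    intro l
    induction l using hwf.induction with
    | _ l ih =>
      rw [Acc.rank_eq]
      refine Ordinal.iSup_le fun ⟨s, hs⟩ => ?_
      exact Order.succ_le_of_lt ((ih s hs).trans_lt (hdec s l hs))
  have hlow : ∀ l, l.Pairwise (· < ·) → SchreierList r α l →
      (galvinEnd r α l).1 ≤ (hwf.apply l).rank := by
    intro l
    induction l using hwf.induction with
    | _ l ih =>
      intro hl hS
      refine le_of_forall_lt fun γ hγ => ?_
      have hγ1 : γ < Ordinal.omega 1 := hγ.trans (galvinEnd r α l).2
      obtain ⟨n, hn⟩ := (hr.union ⟨γ, hγ1⟩ (galvinEnd r α l)).1 hγ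
      set m := n + l.sum + 1 with hm
      have hm' : r m ⟨γ, hγ1⟩ (galvinEnd r α l) := hr.mono n m (by omega) _ _ hn
      have hp : (l ++ [m]).Pairwise (· < ·) := by
        rw [List.pairwise_append]
        refine ⟨hl, by simp, ?_⟩
        intro x hx y hy
        have := List.le_sum_of_mem hx
        simp at hy
        omega
      have hSm : SchreierList r α (l ++ [m]) :=
        schreierList_append hr [m] l α hl hS ⟨_, hm', trivial⟩
      have ht : treeRel (Schreier r α) (l ++ [m]) l :=
        (treeRel_schreier r α _ _).2 ⟨hp, hSm, m, rfl⟩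
      have h1 := ih _ ht hp hSm
      have h2 : γ ≤ (galvinEnd r α (l ++ [m])).1 := by
        have he : galvinEnd r α (l ++ [m]) = galvinPred r m (galvinEnd r α l) := by
          simp [galvinEnd]
        rw [he]
        rcases (galvinPred_spec hr hm').2 with h | h
        · rw [← h]
        · exact le_of_lt ((hr.union _ _).2 ⟨m, h⟩)
      exact (h2.trans h1).trans_lt (Acc.rank_lt_of_rel (hwf.apply l) ht)
  unfold rho
  rw [dif_pos hwf]
  exact le_antisymm (hup []) (hlow [] List.Pairwise.nil trivial)
end

section
/- Fix a Galvin decomposition (<_n) of ω₁ satisfying 0 <_n ξ for all 0 < ξ < ω₁ and all n. For every countable ordinal α > 0, δ(𝒫_α) = ω^α, where ω^α is ordinal exponentiation. -/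
open Ordinal Filter
open scoped ENNReal
/-- `𝒫`: partial functions `u` with finite domain such that `u(k) < 2^k` on the domain
(normalized to be `0` off the domain). -/
structure PFn where
  dom : Finset ℕ
  val : ℕ → ℕ
  lt : ∀ k ∈ dom, val k < 2 ^ k
  out : ∀ k ∉ dom, val k = 0

/-- Two partial functions are compatible iff they agree on the intersection of their
domains (equivalently, their union is a function). -/
def Compat (u v : PFn) : Prop := ∀ k ∈ u.dom, k ∈ v.dom → u.val k = v.val k

/-- `G` is a finite pairwise-incompatible subset of `F` (a member of `D(F)`) properly
extending `H`. -/
def deltaRel (F : Set PFn) (G H : Set PFn) : Prop :=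
  (G.Finite ∧ G ⊆ F ∧ G.Pairwise fun u v => ¬ Compat u v) ∧ H ⊂ G

open Classical in
/-- `δ(F)`: the well-founded rank of `(D(F), ⊋)`, i.e. the rank of `∅`. -/
noncomputable def delta (F : Set PFn) : Ordinal :=
  if h : WellFounded (deltaRel F) then (h.apply (∅ : Set PFn)).rank else 0


noncomputable def nad (a b : Ordinal.{0}) : Ordinal.{0} :=
  max (⨆ x : Set.Iio a, Order.succ (nad x.1 b)) (⨆ x : Set.Iio b, Order.succ (nad a x.1))
termination_by (a, b)
decreasing_by
  · exact Prod.Lex.left _ _ x.2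
  · exact Prod.Lex.right _ x.2

theorem nad_lt_left {a a' : Ordinal.{0}} (b : Ordinal.{0}) (h : a' < a) : nad a' b < nad a b := by
  conv_rhs => rw [nad]
  refine lt_of_lt_of_le ?_ (le_max_left _ _)
  exact lt_of_lt_of_le (Order.lt_succ _)
    (Ordinal.le_iSup (fun x : Set.Iio a => Order.succ (nad x.1 b)) ⟨a', h⟩)

theorem nad_lt_right (a : Ordinal.{0}) {b b' : Ordinal.{0}} (h : b' < b) : nad a b' < nad a b := by
  conv_rhs => rw [nad]
  refine lt_of_lt_of_le ?_ (le_max_right _ _)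
  exact lt_of_lt_of_le (Order.lt_succ _)
    (Ordinal.le_iSup (fun x : Set.Iio b => Order.succ (nad a x.1)) ⟨b', h⟩)

theorem nad_le {a b c : Ordinal.{0}} (h1 : ∀ a' < a, nad a' b < c) (h2 : ∀ b' < b, nad a b' < c) :
    nad a b ≤ c := by
  rw [nad]
  refine max_le (Ordinal.iSup_le fun x => Order.succ_le_of_lt (h1 _ x.2))
    (Ordinal.iSup_le fun x => Order.succ_le_of_lt (h2 _ x.2))

theorem nad_mono {a a' b b' : Ordinal.{0}} (h : a ≤ a') (h' : b ≤ b') : nad a b ≤ nad a' b' := by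
  have h1 : nad a b ≤ nad a' b := by
    rcases h.eq_or_lt with rfl | h
    · exact le_rfl
    · exact (nad_lt_left b h).le
  have h2 : nad a' b ≤ nad a' b' := by
    rcases h'.eq_or_lt with rfl | h
    · exact le_rfl
    · exact (nad_lt_right a' h).le
  exact h1.trans h2

theorem nad_aux (w : Ordinal.{0}) (hw : ∀ x < w, ∀ y < w, nad x y < w) :
    ∀ a b : Ordinal.{0}, ∀ p q : ℕ, ∀ x < w, ∀ y < w, a = w * p + x → b = w * q + y →
      nad a b ≤ w * ((p + q : ℕ) : Ordinal) + nad x y := by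
  intro a
  induction a using WellFoundedLT.induction with
  | ind a iha =>
  intro b
  induction b using WellFoundedLT.induction with
  | ind b ihb =>
  intro p q x hx y hy ha hb
  have key : ∀ n m : ℕ, n < m → ∀ z < w, w * (n : Ordinal) + z < w * (m : Ordinal) := by
    intro n m hnm z hz
    calc w * (n : Ordinal) + z < w * (n : Ordinal) + w := by gcongr
      _ = w * ((n + 1 : ℕ) : Ordinal) := by push_cast; rw [mul_add, mul_one]
      _ ≤ w * (m : Ordinal) := by
        gcongr
        omega
  apply nad_le
  · intro a' ha'
    rcases lt_or_ge a' (w * p) with h | h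
    · obtain ⟨s, hs, t, ht, rfl⟩ := Ordinal.lt_mul_iff.1 h
      obtain ⟨s, rfl⟩ := Ordinal.lt_omega0.1 (hs.trans (Ordinal.natCast_lt_omega0 p))
      have hs' : s < p := by exact_mod_cast hs
      calc _ ≤ _ := iha _ ha' b s q t ht y hy rfl hb
        _ < w * ((p + q : ℕ) : Ordinal) := key _ _ (by omega) _ (hw _ ht _ hy)
        _ ≤ _ := le_self_add
    · have h1 := Ordinal.add_sub_cancel_of_le h
      set x' := a' - w * p
      have hx' : x' < x := by
        rw [← h1, ha] at ha'
        exact lt_of_add_lt_add_left ha'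
      calc _ ≤ _ := iha _ ha' b p q x' (hx'.trans hx) y hy h1.symm hb
        _ < _ := by
          have := nad_lt_left y hx'
          gcongr
  · intro b' hb'
    rcases lt_or_ge b' (w * q) with h | h
    · obtain ⟨s, hs, t, ht, rfl⟩ := Ordinal.lt_mul_iff.1 h
      obtain ⟨s, rfl⟩ := Ordinal.lt_omega0.1 (hs.trans (Ordinal.natCast_lt_omega0 q))
      have hs' : s < q := by exact_mod_cast hs
      calc _ ≤ _ := ihb _ hb' p s x hx t ht ha rfl
        _ < w * ((p + q : ℕ) : Ordinal) := key _ _ (by omega) _ (hw _ hx _ ht)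
        _ ≤ _ := le_self_add
    · have h1 := Ordinal.add_sub_cancel_of_le h
      set x' := b' - w * q
      have hx' : x' < y := by
        rw [← h1, hb] at hb'
        exact lt_of_add_lt_add_left hb'
      calc _ ≤ _ := ihb _ hb' p q x hx x' (hx'.trans hy) ha h1.symm
        _ < _ := by
          have := nad_lt_right x hx'
          gcongr

theorem nad_lt_opow (γ : Ordinal.{0}) :
    ∀ a < ω ^ γ, ∀ b < ω ^ γ, nad a b < ω ^ γ := by
  induction γ using WellFoundedLT.induction with
  | ind γ ih =>
  intro a ha b hb
  have hz : nad 0 0 ≤ 0 := nad_le (fun x hx => absurd hx not_lt_zero) (fun x hx => absurd hx not_lt_zero)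
  rcases eq_or_ne γ 0 with rfl | hγ
  · rw [opow_zero, Order.lt_one_iff] at *
    subst ha hb
    exact le_antisymm hz zero_le
  · obtain ⟨c, hc, n, hn⟩ := (lt_omega0_opow hγ).1 ha
    obtain ⟨d, hd, m, hm⟩ := (lt_omega0_opow hγ).1 hb
    have he : max c d < γ := max_lt hc hd
    have ha' : a ≤ ω ^ (max c d) * n + 0 := by
      rw [add_zero]
      refine hn.le.trans ?_
      gcongr
      · exact omega0_pos
      · exact le_max_left _ _
    have hb' : b ≤ ω ^ (max c d) * m + 0 := by
      rw [add_zero]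
      refine hm.le.trans ?_
      gcongr
      · exact omega0_pos
      · exact le_max_right _ _
    have hpos : 0 < ω ^ (max c d) := opow_pos _ omega0_pos
    calc nad a b ≤ _ := nad_mono ha' hb'
      _ ≤ _ := nad_aux _ (ih _ he) _ _ n m 0 hpos 0 hpos rfl rfl
      _ ≤ ω ^ (max c d) * ((n + m : ℕ) : Ordinal) := by
        rw [le_antisymm hz zero_le, add_zero]
      _ < ω ^ γ := (lt_omega0_opow hγ).2 ⟨_, he, n + m + 1, by
        have h1 : ((n + m : ℕ) : Ordinal.{0}) < ((n + m + 1 : ℕ) : Ordinal.{0}) := by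
          exact_mod_cast Nat.lt_succ_self _
        exact mul_lt_mul_of_pos_left h1 hpos⟩

def Dec (F : Set PFn) (f : Set PFn → Ordinal.{0}) : Prop :=
  ∀ G H, deltaRel F G H → f G < f H

def UB (F : Set PFn) (o : Ordinal.{0}) : Prop := ∃ f, Dec F f ∧ f ∅ ≤ o

def LB (F : Set PFn) (o : Ordinal.{0}) : Prop := ∀ f, Dec F f → o ≤ f ∅

theorem Dec.wf {F : Set PFn} {f} (h : Dec F f) : WellFounded (deltaRel F) :=
  Subrelation.wf (r := InvImage (· < ·) f) (fun {G H} hGH => h G H hGH)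
    (InvImage.wf f wellFounded_lt)

theorem Dec.rank_le {F : Set PFn} {f} (h : Dec F f) (G : Set PFn) (hG : Acc (deltaRel F) G) :
    hG.rank ≤ f G := by
  induction hG with
  | intro G hacc ih =>
  rw [Acc.rank_eq]
  refine Ordinal.iSup_le fun x => Order.succ_le_of_lt ?_
  exact lt_of_le_of_lt (ih x.1 x.2) (h _ _ x.2)

theorem delta_eq {F : Set PFn} {o : Ordinal.{0}} (h1 : UB F o) (h2 : LB F o) : delta F = o := by
  obtain ⟨f, hf, hfo⟩ := h1
  have hw := hf.wf
  rw [delta, dif_pos hw]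
  apply le_antisymm
  · exact (hf.rank_le _ _).trans hfo
  · exact h2 (fun G => (hw.apply G).rank) (fun G H hGH => Acc.rank_lt_of_rel (hw.apply H) hGH)

theorem Dec.anti {F F' : Set PFn} {f} (h : Dec F f) (hF : F' ⊆ F) : Dec F' f :=
  fun G H hGH => h G H ⟨⟨hGH.1.1, hGH.1.2.1.trans hF, hGH.1.2.2⟩, hGH.2⟩

theorem UB.anti {F F' : Set PFn} {o} (h : UB F o) (hF : F' ⊆ F) : UB F' o := by
  obtain ⟨f, hf, ho⟩ := h
  exact ⟨f, hf.anti hF, ho⟩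

theorem LB.mono {F F' : Set PFn} {o} (h : LB F o) (hF : F ⊆ F') : LB F' o :=
  fun f hf => h f (hf.anti hF)

theorem UB.empty : UB ∅ 0 := by
  refine ⟨fun _ => 0, fun G H h => ?_, le_rfl⟩
  exact absurd (h.1.2.1) (fun hs => h.2.2 (hs.trans (Set.empty_subset _)))

theorem UB.union {F F' : Set PFn} {o o'} (h : UB F o) (h' : UB F' o') :
    UB (F ∪ F') (nad o o') := by
  obtain ⟨f, hf, ho⟩ := h
  obtain ⟨f', hf', ho'⟩ := h'
  refine ⟨fun G => nad (f (G ∩ F)) (f' (G ∩ F')), ?_, ?_⟩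
  · rintro G H ⟨⟨h1, h2, h3⟩, h4⟩
    have good : ∀ A : Set PFn, (G ∩ A).Finite ∧ G ∩ A ⊆ A ∧
        (G ∩ A).Pairwise fun u v => ¬ Compat u v := fun A =>
      ⟨h1.subset Set.inter_subset_left, Set.inter_subset_right, h3.mono Set.inter_subset_left⟩
    have sub : ∀ A : Set PFn, H ∩ A ⊆ G ∩ A := fun A => Set.inter_subset_inter_left _ h4.1
    have c1 : H ∩ F ⊂ G ∩ F → f (G ∩ F) < f (H ∩ F) := fun h => hf _ _ ⟨good F, h⟩
    have c2 : H ∩ F' ⊂ G ∩ F' → f' (G ∩ F') < f' (H ∩ F') := fun h => hf' _ _ ⟨good F', h⟩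
    rcases (sub F).eq_or_ssubset with e1 | e1
    · rcases (sub F').eq_or_ssubset with e2 | e2
      · exfalso
        apply h4.2
        intro u hu
        rcases h2 hu with hF | hF
        · exact (e1.symm ▸ (⟨hu, hF⟩ : u ∈ G ∩ F) : u ∈ H ∩ F).1
        · exact (e2.symm ▸ (⟨hu, hF⟩ : u ∈ G ∩ F') : u ∈ H ∩ F').1
      · simp only [e1]
        exact nad_lt_right _ (c2 e2)
    · refine lt_of_lt_of_le (nad_lt_left _ (c1 e1)) (nad_mono le_rfl ?_)
      rcases (sub F').eq_or_ssubset with e2 | e2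
      · rw [e2]
      · exact (c2 e2).le
  · simp only [Set.empty_inter]
    exact nad_mono ho ho'

theorem UB.iUnion {ι : Type*} [Finite ι] (F : ι → Set PFn) (γ : Ordinal.{0})
    (h : ∀ i, ∃ o < ω ^ γ, UB (F i) o) : ∃ o < ω ^ γ, UB (⋃ i, F i) o := by
  classical
  have := Fintype.ofFinite ι
  have key : ∀ s : Finset ι, ∃ o < ω ^ γ, UB (⋃ i ∈ s, F i) o := by
    intro s
    induction s using Finset.induction_on with
    | empty => exact ⟨0, opow_pos _ omega0_pos, by simpa using UB.empty⟩
    | insert a s ha ih =>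
      obtain ⟨o, ho, hu⟩ := ih
      obtain ⟨o', ho', hu'⟩ := h a
      refine ⟨_, nad_lt_opow γ _ ho' _ ho, ?_⟩
      rw [Finset.set_biUnion_insert]
      exact hu'.union hu
  simpa using key Finset.univ

theorem deltaRel_image {F F' : Set PFn} (φ : PFn → PFn) (hinj : Set.InjOn φ F)
    (hmap : Set.MapsTo φ F F') (hc : ∀ u ∈ F, ∀ v ∈ F, Compat (φ u) (φ v) → Compat u v)
    (G H : Set PFn) (h : deltaRel F G H) : deltaRel F' (φ '' G) (φ '' H) := by
  obtain ⟨⟨h1, h2, h3⟩, h4⟩ := h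
  refine ⟨⟨h1.image _, ?_, ?_⟩, ?_⟩
  · rintro _ ⟨u, hu, rfl⟩
    exact hmap (h2 hu)
  · rintro _ ⟨u, hu, rfl⟩ _ ⟨v, hv, rfl⟩ hne hcc
    exact h3 hu hv (fun e => hne (e ▸ rfl)) (hc u (h2 hu) v (h2 hv) hcc)
  · refine ⟨Set.image_mono h4.1, fun hs => h4.2 fun u hu => ?_⟩
    obtain ⟨v, hv, e⟩ := hs ⟨u, hu, rfl⟩
    rwa [← hinj (h2 (h4.1 hv)) (h2 hu) e]

theorem UB.comap {F F' : Set PFn} {o} (h : UB F' o) (φ : PFn → PFn) (hinj : Set.InjOn φ F)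
    (hmap : Set.MapsTo φ F F') (hc : ∀ u ∈ F, ∀ v ∈ F, Compat (φ u) (φ v) → Compat u v) :
    UB F o := by
  obtain ⟨f, hf, ho⟩ := h
  exact ⟨fun G => f (φ '' G), fun G H h => hf _ _ (deltaRel_image φ hinj hmap hc G H h),
    by simpa using ho⟩

theorem LB.map {F F' : Set PFn} {o} (h : LB F o) (φ : PFn → PFn) (hinj : Set.InjOn φ F)
    (hmap : Set.MapsTo φ F F') (hc : ∀ u ∈ F, ∀ v ∈ F, Compat (φ u) (φ v) → Compat u v) :
    LB F' o := by
  intro f hf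
  simpa using h (fun G => f (φ '' G))
    fun G H h => hf _ _ (deltaRel_image φ hinj hmap hc G H h)

theorem UB.step {F : Set PFn} {o : Ordinal.{0}}
    (h : ∀ u ∈ F, ∃ o' < o, UB {v | v ∈ F ∧ ¬ Compat u v} o') : UB F o := by
  classical
  have h' : ∀ u, ∃ f : Set PFn → Ordinal.{0}, u ∈ F →
      Dec {v | v ∈ F ∧ ¬ Compat u v} f ∧ f ∅ < o := by
    intro u
    by_cases hu : u ∈ F
    · obtain ⟨o', ho', f, hf, hfo⟩ := h u hu
      exact ⟨f, fun _ => ⟨hf, hfo.trans_lt ho'⟩⟩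
    · exact ⟨fun _ => 0, fun h => absurd h hu⟩
  choose f hf using h'
  have good : ∀ G : Set PFn, (G.Finite ∧ G ⊆ F ∧ G.Pairwise fun u v => ¬ Compat u v) →
      ∀ u ∈ G, ((G \ {u}).Finite ∧ G \ {u} ⊆ {v | v ∈ F ∧ ¬ Compat u v} ∧
        (G \ {u}).Pairwise fun u v => ¬ Compat u v) := by
    rintro G ⟨h1, h2, h3⟩ u hu
    refine ⟨h1.subset Set.sdiff_subset, ?_, h3.mono Set.sdiff_subset⟩
    rintro v ⟨hv, hne⟩
    exact ⟨h2 hv, h3 hu hv (fun e => hne e.symm)⟩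
  refine ⟨fun G => if G = ∅ then o else sInf ((fun u => f u (G \ {u})) '' G), ?_, by simp⟩
  rintro G H ⟨hG, hHG⟩
  have hGne : G ≠ ∅ := by
    rintro rfl
    exact hHG.2 (Set.empty_subset _)
  simp only [if_neg hGne]
  by_cases hH : H = ∅
  · simp only [if_pos hH]
    obtain ⟨u, hu⟩ := Set.nonempty_iff_ne_empty.2 hGne
    refine (csInf_le' (Set.mem_image_of_mem _ hu)).trans_lt ?_
    have huF := hf u (hG.2.1 hu)
    refine lt_of_le_of_lt ?_ huF.2
    rcases (G \ {u}).eq_empty_or_nonempty with e | e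
    · simp only [e, le_refl]
    · exact (huF.1 _ _ ⟨good G hG u hu, Set.empty_ssubset.2 e⟩).le
  · simp only [if_neg hH]
    have hne : ((fun u => f u (H \ {u})) '' H).Nonempty :=
      (Set.nonempty_iff_ne_empty.2 hH).image _
    obtain ⟨u, hu, e⟩ := csInf_mem hne
    rw [← e]
    have huG := hHG.1 hu
    refine (csInf_le' (Set.mem_image_of_mem _ huG)).trans_lt ?_
    refine (hf u (hG.2.1 huG)).1 _ _ ⟨good G hG u huG, ?_⟩
    refine ⟨Set.sdiff_subset_sdiff_left hHG.1, fun hs => hHG.2 fun v hv => ?_⟩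
    by_cases hvu : v = u
    · rwa [hvu]
    · exact (hs ⟨hv, hvu⟩).1

theorem LB.add {F F1 F2 : Set PFn} {o1 o2} (h1 : LB F1 o1) (h2 : LB F2 o2)
    (hF1 : F1 ⊆ F) (hF2 : F2 ⊆ F) (hc : ∀ u ∈ F1, ∀ v ∈ F2, ¬ Compat u v ∧ ¬ Compat v u) :
    LB F (o2 + o1) := by
  intro f hf
  have hdis : ∀ u ∈ F1, u ∉ F2 := fun u hu hu' => (hc u hu u hu').1 (fun _ _ _ => rfl)
  have key : ∀ G : Set PFn, (G.Finite ∧ G ⊆ F1 ∧ G.Pairwise fun u v => ¬ Compat u v) →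
      o2 ≤ f G := by
    rintro G ⟨g1, g2, g3⟩
    have := h2 (fun G2 => f (G ∪ G2)) ?_
    · simpa using this
    · rintro G' H' ⟨⟨k1, k2, k3⟩, k4⟩
      refine hf _ _ ⟨⟨g1.union k1, Set.union_subset (g2.trans hF1) (k2.trans hF2), ?_⟩, ?_⟩
      · rintro u (hu | hu) v (hv | hv) hne
        · exact g3 hu hv hne
        · exact (hc u (g2 hu) v (k2 hv)).1
        · exact (hc v (g2 hv) u (k2 hu)).2
        · exact k3 hu hv hne
      · refine ⟨Set.union_subset_union_right _ k4.1, fun hs => k4.2 fun v hv => ?_⟩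
        rcases hs (Or.inr hv) with hv' | hv'
        · exact absurd (k2 hv) (hdis _ (g2 hv'))
        · exact hv'
  have h3 := h1 (fun G => f G - o2) ?_
  · have h4 : o2 ≤ f ∅ := key ∅ ⟨Set.finite_empty, Set.empty_subset _, Set.pairwise_empty _⟩
    calc o2 + o1 ≤ o2 + (f ∅ - o2) := by gcongr
      _ = f ∅ := Ordinal.add_sub_cancel_of_le h4
  · rintro G H hGH
    have hlt := hf G H ⟨⟨hGH.1.1, hGH.1.2.1.trans hF1, hGH.1.2.2⟩, hGH.2⟩
    rw [Ordinal.lt_sub, Ordinal.add_sub_cancel_of_le (key G hGH.1)]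
    exact hlt

theorem PFn.ext' {u v : PFn} (h1 : u.dom = v.dom) (h2 : u.val = v.val) : u = v := by
  cases u; cases v; simp_all

theorem IsGalvin.mono' {r : ℕ → Omega1.{0} → Omega1.{0} → Prop} (hr : IsGalvin r) {n m : ℕ} (h : n ≤ m)
    {a b : Omega1.{0}} (hab : r n a b) : r m a b := by
  rcases h.eq_or_lt with rfl | h
  · exact hab
  · exact hr.mono n m h _ _ hab

theorem schreierList_sublist {r : ℕ → Omega1.{0} → Omega1.{0} → Prop} (hr : IsGalvin r) {l l' : List ℕ}
    (h : l'.Sublist l) : ∀ a : Omega1.{0}, l.Pairwise (· ≤ ·) → SchreierList r a l →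
      SchreierList r a l' := by
  induction h with
  | slnil => intro a _ h; exact h
  | @cons l₁ l₂ n hs ih =>
    intro a hp ⟨b, hb, hl⟩
    rw [List.pairwise_cons] at hp
    have h1 := ih b hp.2 hl
    cases l₁ with
    | nil => trivial
    | cons k t =>
      obtain ⟨c, hc, ht⟩ := h1
      have hk : n ≤ k := hp.1 k (hs.subset (by simp))
      exact ⟨c, hr.trans _ _ _ _ hc (hr.mono' hk hb), ht⟩
  | @cons_cons l₁ l₂ n hs ih =>
    intro a hp ⟨b, hb, hl⟩
    rw [List.pairwise_cons] at hp
    exact ⟨b, hb, ih b hp.2 hl⟩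

theorem schreierList_split {r : ℕ → Omega1.{0} → Omega1.{0} → Prop} (hr : IsGalvin r) (m : ℕ) (l : List ℕ) :
    ∀ a : Omega1.{0}, l.Pairwise (· ≤ ·) → SchreierList r a l → (∃ k ∈ l, k ≤ m) →
      ∃ b, r m b a ∧ SchreierList r b (l.filter (fun k => decide (m < k))) := by
  induction l with
  | nil => rintro a _ _ ⟨k, hk, _⟩; simp at hk
  | cons n l ih =>
    rintro a hp ⟨b, hb, hl⟩ ⟨k, hk, hkm⟩
    rw [List.pairwise_cons] at hp
    have hn : n ≤ m := by
      rcases List.mem_cons.1 hk with rfl | hk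
      · exact hkm
      · exact (hp.1 k hk).trans hkm
    rw [List.filter_cons_of_neg (by simpa using hn)]
    by_cases hex : ∃ k ∈ l, k ≤ m
    · obtain ⟨c, hc, hcl⟩ := ih b hp.2 hl hex
      exact ⟨c, hr.trans _ _ _ _ hc (hr.mono' hn hb), hcl⟩
    · exact ⟨b, hr.mono' hn hb, schreierList_sublist hr List.filter_sublist b hp.2 hl⟩

theorem sort_filter_eq (s : Finset ℕ) (p : ℕ → Prop) [DecidablePred p] :
    (s.filter p).sort (· ≤ ·) = (s.sort (· ≤ ·)).filter (fun k => decide (p k)) := by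
  have h1 : ((s.sort (· ≤ ·)).filter (fun k => decide (p k))).toFinset = s.filter p := by
    ext k; simp
  have h2 := (s.pairwise_sort (· ≤ ·)).filter (fun k => decide (p k))
  have h3 : ((s.sort (· ≤ ·)).filter (fun k => decide (p k))).Nodup :=
    (s.sort_nodup (· ≤ ·)).filter _
  rw [← h1]
  exact (List.toFinset_sort (· ≤ ·) h3).2 h2

theorem schreier_subset {r : ℕ → Omega1.{0} → Omega1.{0} → Prop} (hr : IsGalvin r) {a : Omega1.{0}} {A B : Finset ℕ}
    (hAB : A ⊆ B) (hB : B ∈ Schreier r a) : A ∈ Schreier r a := by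
  have h : A = B.filter (· ∈ A) := by
    ext k
    simp only [Finset.mem_filter]
    exact ⟨fun h => ⟨hAB h, h⟩, fun h => h.2⟩
  rw [h]
  change SchreierList r a _
  rw [sort_filter_eq]
  exact schreierList_sublist hr List.filter_sublist a (B.pairwise_sort (· ≤ ·)) hB

theorem norm_le_one {r : ℕ → Omega1.{0} → Omega1.{0} → Prop} (hr : IsGalvin r)
    (h0 : ∀ (n : ℕ) (z ξ : Omega1.{0}), z.1 = 0 → 0 < ξ.1 → r n z ξ)
    (α : Omega1.{0}) (hα : 0 < α.1) (A : Finset ℕ) :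
    normOf (Schreier r α) A ≤ 1 ↔ A ∈ Schreier r α := by
  constructor
  · intro h
    have hne : {n | ∃ c : Finset (Finset ℕ), ↑c ⊆ Schreier r α ∧ c.card = n ∧
        A ⊆ c.biUnion id}.Nonempty := by
      refine ⟨_, A.image (fun k => {k}), ?_, rfl, ?_⟩
      · intro B hB
        simp only [Finset.coe_image, Set.mem_image] at hB
        obtain ⟨k, _, rfl⟩ := hB
        change SchreierList r α _
        rw [Finset.sort_singleton]
        exact ⟨⟨0, hα.trans α.2⟩, h0 _ _ _ rfl hα, trivial⟩
      · intro k hk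
        simp only [Finset.mem_biUnion, Finset.mem_image, id]
        exact ⟨{k}, ⟨k, hk, rfl⟩, by simp⟩
    obtain ⟨c, hc, hcard, hA⟩ := Nat.sInf_mem hne
    have hcard' : c.card ≤ 1 := hcard.trans_le h
    rcases Nat.le_one_iff_eq_zero_or_eq_one.1 hcard' with h1 | h1
    · rw [Finset.card_eq_zero] at h1
      subst h1
      have : A = ∅ := by simpa using hA
      subst this
      change SchreierList r α _
      rw [Finset.sort_empty]
      trivial
    · obtain ⟨B, rfl⟩ := Finset.card_eq_one.1 h1
      have hAB : A ⊆ B := by simpa using hA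
      exact schreier_subset hr hAB (hc (by simp))
  · intro h
    refine Nat.sInf_le ⟨{A}, ?_, by simp, by simp⟩
    simpa using h

theorem preds_finite {r : ℕ → Omega1.{0} → Omega1.{0} → Prop} (hr : IsGalvin r) (m : ℕ) (a : Omega1.{0}) :
    {b | r m b a}.Finite := by
  by_contra hinf
  obtain ⟨k, hk⟩ := hr.finHeight m
  obtain ⟨s, hs, hcard⟩ := Set.Infinite.exists_subset_card_eq hinf (k + 1)
  have h1 : (s.sort (· ≤ ·)).Pairwise (r m) := by
    have h2 := (s.sortedLT_sort).pairwise
    refine h2.imp_of_mem ?_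
    intro b c hb hc hlt
    rw [Finset.mem_sort] at hb hc
    rcases hr.tree m a b c (hs hb) (hs hc) with h | h | h
    · exact h
    · exact absurd hlt (not_lt.2 ((hr.union _ _).2 ⟨m, h⟩).le)
    · exact absurd hlt (h ▸ lt_irrefl _)
  have h3 := hk _ h1.isChain
  rw [Finset.length_sort] at h3
  omega

def QQ (r : ℕ → Omega1.{0} → Omega1.{0} → Prop) (b : Omega1.{0}) (N : ℕ) : Set PFn :=
  {v | v.dom ∈ Schreier r b ∧ ∀ k ∈ v.dom, N ≤ k}

/-- restriction to `(m, ∞)` -/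
noncomputable def cut (m : ℕ) (v : PFn) : PFn where
  dom := v.dom.filter (fun k => m < k)
  val := fun k => if m < k then v.val k else 0
  lt := by
    intro k hk
    rw [Finset.mem_filter] at hk
    rw [if_pos hk.2]
    exact v.lt k hk.1
  out := by
    intro k hk
    rw [Finset.mem_filter] at hk
    split_ifs with h
    · exact v.out k (fun h' => hk ⟨h', h⟩)
    · rfl

theorem PFn.val_lt (v : PFn) (k : ℕ) : v.val k < 2 ^ k := by
  by_cases h : k ∈ v.dom
  · exact v.lt k h
  · rw [v.out k h]; positivity

theorem UB_QQ {r : ℕ → Omega1.{0} → Omega1.{0} → Prop} (hr : IsGalvin r) (o : Ordinal.{0}) :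
    ∀ a : Omega1.{0}, a.1 = o → UB (QQ r a 0) (ω ^ o) := by
  induction o using WellFoundedLT.induction with
  | ind o ih =>
  rintro a rfl
  apply UB.step
  intro u hu
  set m := u.dom.sup id with hm
  have hfin : Finite {b | r m b a} := preds_finite hr m a
  let ι := (Set (Fin (m+1)) × ((k : Fin (m+1)) → Fin (2 ^ (k : ℕ)))) × {b | r m b a}
  let code : PFn → Set (Fin (m+1)) × ((k : Fin (m+1)) → Fin (2 ^ (k : ℕ))) := fun v =>
    ({k | (k : ℕ) ∈ v.dom}, fun k => ⟨v.val k, v.val_lt k⟩)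
  let F : ι → Set PFn := fun i => {v | code v = i.1 ∧ (cut m v).dom ∈ Schreier r i.2.1}
  have hcode : ∀ v w, code v = code w → ∀ k ≤ m, (k ∈ v.dom ↔ k ∈ w.dom) ∧ v.val k = w.val k := by
    intro v w h k hk
    have h1 := congrArg (fun x => (⟨k, by omega⟩ : Fin (m+1)) ∈ x.1) h
    have h2 := congrArg (fun x => (x.2 (⟨k, by omega⟩ : Fin (m+1))).1) h
    exact ⟨iff_of_eq h1, h2⟩
  have hF : ∀ i, ∃ o' < ω ^ a.1, UB (F i) o' := by
    rintro ⟨w, b, hb⟩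
    have hlt : b < a := (hr.union _ _).2 ⟨m, hb⟩
    have hlt' : b.1 < a.1 := hlt
    refine ⟨ω ^ b.1, (opow_lt_opow_iff_right one_lt_omega0).2 hlt', ?_⟩
    refine (ih b.1 hlt' b rfl).comap (cut m) ?_ ?_ ?_
    · rintro v ⟨hv, -⟩ v' ⟨hv', -⟩ e
      have hcc := hcode v v' (hv.trans hv'.symm)
      have e1 := congrArg PFn.dom e
      have e2 := congrArg PFn.val e
      apply PFn.ext'
      · ext k
        by_cases hk : k ≤ m
        · exact (hcc k hk).1
        · have := congrArg (k ∈ ·) e1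
          simpa [cut, not_le.1 hk] using this
      · ext k
        by_cases hk : k ≤ m
        · exact (hcc k hk).2
        · have := congrFun e2 k
          simpa [cut, not_le.1 hk] using this
    · rintro v ⟨-, hv⟩
      exact ⟨hv, fun k _ => Nat.zero_le k⟩
    · rintro v ⟨hv, -⟩ v' ⟨hv', -⟩ hc k hk hk'
      have hcc := hcode v v' (hv.trans hv'.symm)
      by_cases hkm : k ≤ m
      · exact (hcc k hkm).2
      · have := hc k (by simp [cut, hk]; omega) (by simp [cut, hk']; omega)
        simpa [cut, not_le.1 hkm] using this
  obtain ⟨o', ho', hU⟩ := UB.iUnion F a.1 hF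
  · refine ⟨o', ho', hU.anti ?_⟩
    rintro v ⟨hv, hc⟩
    simp only [Compat, not_forall] at hc
    obtain ⟨k, hku, hkv, -⟩ := hc
    have hkm : k ≤ m := Finset.le_sup (f := id) hku
    obtain ⟨b, hb, hbl⟩ := schreierList_split hr m (v.dom.sort (· ≤ ·)) a
      (v.dom.pairwise_sort (· ≤ ·)) hv.1 ⟨k, by simpa using hkv, hkm⟩
    refine Set.mem_iUnion.2 ⟨(code v, ⟨b, hb⟩), rfl, ?_⟩
    change SchreierList r b ((v.dom.filter (fun k => m < k)).sort (· ≤ ·))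
    rw [sort_filter_eq]
    exact hbl

/-- add the value `i` at `k` -/
noncomputable def addPt (k i : ℕ) (hi : i < 2 ^ k) (v : PFn) : PFn where
  dom := insert k v.dom
  val := Function.update v.val k i
  lt := by
    intro j hj
    by_cases h : j = k
    · subst h; simpa using hi
    · rw [Function.update_of_ne h]; exact v.val_lt j
  out := by
    intro j hj
    rw [Finset.mem_insert, not_or] at hj
    rw [Function.update_of_ne hj.1]
    exact v.out j hj.2

theorem LB_QQ {r : ℕ → Omega1.{0} → Omega1.{0} → Prop} (hr : IsGalvin r) (o : Ordinal.{0}) :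
    ∀ a : Omega1.{0}, a.1 = o → ∀ N, LB (QQ r a N) (ω ^ o) := by
  induction o using WellFoundedLT.induction with
  | ind o ih =>
  rintro a rfl N
  rcases eq_or_ne a.1 0 with h0 | h0
  · intro f hf
    rw [h0, opow_zero, Order.one_le_iff_pos]
    let e : PFn := ⟨∅, fun _ => 0, by simp, by simp⟩
    refine lt_of_le_of_lt zero_le (hf {e} ∅ ⟨⟨Set.finite_singleton e, ?_, ?_⟩, ?_⟩)
    · rw [Set.singleton_subset_iff]
      refine ⟨?_, by simp [e]⟩
      change SchreierList r a ((∅ : Finset ℕ).sort (· ≤ ·))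
      rw [Finset.sort_empty]
      trivial
    · exact Set.pairwise_singleton _ _
    · exact Set.empty_ssubset.2 (Set.singleton_nonempty e)
  · intro f hf
    refine le_of_forall_lt fun x hx => ?_
    obtain ⟨c, hc, n, hn⟩ := (lt_omega0_opow h0).1 hx
    let b : Omega1.{0} := ⟨c, hc.trans a.2⟩
    obtain ⟨M, hM⟩ := (hr.union b a).1 hc
    obtain ⟨k, hkN, hkM, hkn⟩ : ∃ k, N ≤ k ∧ M ≤ k ∧ n ≤ k :=
      ⟨N + M + n, by omega, by omega, by omega⟩
    have hk2 : n ≤ 2 ^ k := hkn.trans (Nat.lt_two_pow_self).le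
    have hr' : r k b a := hr.mono' hkM hM
    have key : ∀ p : ℕ, p ≤ 2 ^ k →
        LB {v | v ∈ QQ r a N ∧ k ∈ v.dom ∧ v.val k < p} (ω ^ c * (p : Ordinal)) := by
      intro p
      induction p with
      | zero => intro _ f _; simp
      | succ p ihp =>
        intro hp
        have hpk : p < 2 ^ k := hp
        have h1 := ihp (by omega)
        have h2 : LB {v | v ∈ QQ r a N ∧ k ∈ v.dom ∧ v.val k = p} (ω ^ c) := by
          refine (ih c hc b rfl (k + 1)).map (addPt k p hpk) ?_ ?_ ?_
          · rintro v ⟨-, hv⟩ w ⟨-, hw⟩ e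
            have hkv : k ∉ v.dom := fun h => by have := hv k h; omega
            have hkw : k ∉ w.dom := fun h => by have := hw k h; omega
            have e1 : insert k v.dom = insert k w.dom := congrArg PFn.dom e
            have e2 : Function.update v.val k p = Function.update w.val k p := congrArg PFn.val e
            apply PFn.ext'
            · rw [← Finset.erase_insert hkv, e1, Finset.erase_insert hkw]
            · ext j
              by_cases hj : j = k
              · rw [hj, v.out k hkv, w.out k hkw]
              · simpa [hj] using congrFun e2 j
          · rintro v ⟨hvS, hv⟩
            have hkv : k ∉ v.dom := fun h => by have := hv k h; omega
            refine ⟨⟨?_, ?_⟩, ?_, ?_⟩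
            · change SchreierList r a ((insert k v.dom).sort (· ≤ ·))
              rw [Finset.sort_insert _ (fun j hj => by have := hv j hj; omega) hkv]
              exact ⟨b, hr', hvS⟩
            · intro j hj
              rcases Finset.mem_insert.1 hj with rfl | hj
              · exact hkN
              · have := hv j hj; omega
            · exact Finset.mem_insert_self _ _
            · simp [addPt]
          · rintro v ⟨-, hv⟩ w ⟨-, hw⟩ hcc j hj hj'
            have hjk : j ≠ k := by have := hv j hj; omega
            have := hcc j (Finset.mem_insert_of_mem hj) (Finset.mem_insert_of_mem hj')
            simpa [addPt, hjk] using this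
        have h3 := h2.add h1 (F := {v | v ∈ QQ r a N ∧ k ∈ v.dom ∧ v.val k < p + 1}) ?_ ?_ ?_
        · have e : ω ^ c * ((p + 1 : ℕ) : Ordinal) = ω ^ c * (p : Ordinal) + ω ^ c := by
            push_cast
            rw [mul_add, mul_one]
          rw [e]
          exact h3
        · rintro v ⟨hv1, hv2, hv3⟩
          exact ⟨hv1, hv2, by omega⟩
        · rintro v ⟨hv1, hv2, hv3⟩
          exact ⟨hv1, hv2, by omega⟩
        · rintro v ⟨hv1, hv2, hv3⟩ w ⟨hw1, hw2, hw3⟩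
          refine ⟨fun h => ?_, fun h => ?_⟩
          · have := h k hv2 hw2; omega
          · have := h k hw2 hv2; omega
    exact hn.trans_le ((key n hk2).mono (fun v hv => hv.1) f hf)

/-- For any Galvin decomposition of `ω₁` with `0 <ₙ ξ` for all `0 < ξ < ω₁` and all `n`,
and every countable `α > 0`, the poset `𝒫_α = {u ∈ 𝒫 : ‖dom u‖_α ≤ 1}` satisfies
`δ(𝒫_α) = ω^α`. -/
theorem delta_Palpha (r : ℕ → Omega1 → Omega1 → Prop) (hr : IsGalvin r)
    (h0 : ∀ (n : ℕ) (z ξ : Omega1), z.1 = 0 → 0 < ξ.1 → r n z ξ)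
    (α : Omega1) (hα : 0 < α.1) :
    delta {u : PFn | normOf (Schreier r α) u.dom ≤ 1} = Ordinal.omega0 ^ α.1 := by
  have hs : {u : PFn | normOf (Schreier r α) u.dom ≤ 1} = QQ r α 0 := by
    ext u
    simp [QQ, norm_le_one hr h0 α hα]
  rw [hs]
  exact delta_eq (UB_QQ hr _ α rfl) (LB_QQ hr _ α rfl 0)
end

section
/- (Roberts' Selection Lemma for admissible norms) Let ‖·‖ be an admissible norm, let s, t be positive integers, and let I_0, …, I_{s-1} be finite subsets of ℕ with ‖I_l‖ ≥ s·t for all l < s. Then there exist a permutation π of {0, …, s−1} and finite sets J_i ⊆ I_{π(i)} for i < s such that max(J_i) < min(J_{i+1}) for all i < s−1 and ‖J_i‖ = t for all i < s. -/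
open Ordinal Filter
open scoped ENNReal
open Classical in
/-- The finite initial segment `A ∩ [0,n)` of a set `A ⊆ ℕ`. -/
noncomputable def initSeg (A : Set ℕ) (n : ℕ) : Finset ℕ :=
  (Finset.range n).filter (· ∈ A)

/-- An admissible norm on finite subsets of `ℕ`: vanishing on `∅`, equal to `1` on
singletons, monotone, subadditive, unbounded along every infinite set, and spreading. -/
structure IsAdmissibleNorm (nrm : Finset ℕ → ℕ) : Prop where
  empty : nrm ∅ = 0
  singleton : ∀ n : ℕ, nrm {n} = 1
  mono : ∀ A B : Finset ℕ, A ⊆ B → nrm A ≤ nrm B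
  subadd : ∀ A B : Finset ℕ, nrm (A ∪ B) ≤ nrm A + nrm B
  unbounded : ∀ A : Set ℕ, A.Infinite →
    Filter.Tendsto (fun n => nrm (initSeg A n)) Filter.atTop Filter.atTop
  spreading : ∀ A B : Finset ℕ, SpreadLE A B → nrm A ≤ nrm B

theorem roberts_aux (nrm : Finset ℕ → ℕ) (hn : IsAdmissibleNorm nrm) (t : ℕ) (ht : 0 < t)
    {ι : Type} [DecidableEq ι] (s : ℕ) : ∀ (S : Finset ι) (I : ι → Finset ℕ), S.card = s →
    (∀ l ∈ S, s * t ≤ nrm (I l)) →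
    ∃ f : Fin s → ι, ∃ J : Fin s → Finset ℕ, Function.Injective f ∧ (∀ i, f i ∈ S) ∧
      (∀ i, J i ⊆ I (f i)) ∧ (∀ i, nrm (J i) = t) ∧
      (∀ i j : Fin s, i < j → ∀ a ∈ J i, ∀ b ∈ J j, a < b) := by
  induction s with
  | zero =>
    intro S I _ _
    exact ⟨fun i => i.elim0, fun i => i.elim0, fun i => i.elim0, fun i => i.elim0,
      fun i => i.elim0, fun i => i.elim0, fun i => i.elim0⟩
  | succ s ih =>
    intro S I hS hI
    have hex : ∃ n, ∃ l ∈ S, t ≤ nrm ((I l).filter (· < n)) := by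
      have hne : S.Nonempty := by
        rw [← Finset.card_pos]; omega
      obtain ⟨l, hl⟩ := hne
      refine ⟨(I l).sup id + 1, l, hl, ?_⟩
      have h1 : (I l).filter (· < (I l).sup id + 1) = I l := by
        apply Finset.filter_true_of_mem
        intro x hx
        have := Finset.le_sup (f := id) hx
        simp only [id] at this ⊢
        omega
      rw [h1]
      have := hI l hl
      nlinarith
    classical
    obtain ⟨n, hn1, hmin⟩ : ∃ n, (∃ l ∈ S, t ≤ nrm ((I l).filter (· < n))) ∧
        ∀ m < n, ¬ ∃ l ∈ S, t ≤ nrm ((I l).filter (· < m)) :=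
      ⟨Nat.find hex, Nat.find_spec hex, fun m hm => Nat.find_min hex hm⟩
    obtain ⟨l, hl, hlt⟩ := hn1
    have hle : ∀ k ∈ S, nrm ((I k).filter (· < n)) ≤ t := by
      intro k hk
      cases n with
      | zero => simp [hn.empty]
      | succ n =>
        have h1 := hmin n (by omega)
        have h2 : nrm ((I k).filter (· < n)) < t := by
          by_contra hc
          exact h1 ⟨k, hk, by omega⟩
        have h3 : (I k).filter (· < n + 1) ⊆ (I k).filter (· < n) ∪ {n} := by
          intro x hx
          simp only [Finset.mem_filter, Finset.mem_union, Finset.mem_singleton] at hx ⊢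
          by_cases hxn : x = n
          · exact Or.inr hxn
          · exact Or.inl ⟨hx.1, by omega⟩
        have h4 := hn.mono _ _ h3
        have h5 := hn.subadd ((I k).filter (· < n)) {n}
        rw [hn.singleton] at h5
        omega
    obtain ⟨f, J, hf, hfS, hJI, hJt, hJJ⟩ := ih (S.erase l) (fun k => (I k).filter (n ≤ ·))
      (by rw [Finset.card_erase_of_mem hl]; omega) (by
        intro k hk
        have hk := Finset.mem_of_mem_erase hk
        have h1 := hle k hk
        have h2 := hI k hk
        have h3 := hn.subadd ((I k).filter (· < n)) ((I k).filter (n ≤ ·))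
        have h4 : I k ⊆ (I k).filter (· < n) ∪ (I k).filter (n ≤ ·) := by
          intro x hx
          simp only [Finset.mem_filter, Finset.mem_union]
          rcases lt_or_ge x n with h | h
          · exact Or.inl ⟨hx, h⟩
          · exact Or.inr ⟨hx, h⟩
        have h5 := hn.mono _ _ h4
        rw [Nat.succ_mul] at h2
        omega)
    refine ⟨Fin.cons l f, Fin.cons ((I l).filter (· < n)) J, ?_, ?_, ?_, ?_, ?_⟩
    · rw [Fin.cons_injective_iff]
      refine ⟨?_, hf⟩
      rintro ⟨i, rfl⟩
      exact Finset.notMem_erase _ _ (hfS i)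
    · intro i
      refine Fin.cases ?_ (fun i => ?_) i
      · simpa using hl
      · simpa using Finset.mem_of_mem_erase (hfS i)
    · intro i
      refine Fin.cases ?_ (fun i => ?_) i
      · simp
      · simpa using (hJI i).trans (Finset.filter_subset _ _)
    · intro i
      refine Fin.cases ?_ (fun i => ?_) i
      · simpa using le_antisymm (hle l hl) hlt
      · simpa using hJt i
    · intro i j
      refine Fin.cases ?_ (fun i => ?_) i
      · refine Fin.cases ?_ (fun j => ?_) j
        · intro h; exact absurd h (lt_irrefl _)
        · intro _ a ha b hb
          simp only [Fin.cons_zero, Fin.cons_succ] at ha hb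
          have h1 := (Finset.mem_filter.1 ha).2
          have h2 := (Finset.mem_filter.1 (hJI j hb)).2
          omega
      · refine Fin.cases ?_ (fun j => ?_) j
        · intro h; exact absurd h (Fin.not_lt_zero _)
        · intro h a ha b hb
          simp only [Fin.cons_succ] at ha hb
          exact hJJ i j (Fin.succ_lt_succ_iff.1 h) a ha b hb

/-- Roberts' Selection Lemma for admissible norms: given `s` finite sets each of norm
`≥ s·t`, one can select, after a permutation, consecutive blocks `Jᵢ ⊆ I_{π(i)}` with
`J₀ < J₁ < … < J_{s-1}` and `‖Jᵢ‖ = t`. -/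
theorem roberts_selection (nrm : Finset ℕ → ℕ) (hn : IsAdmissibleNorm nrm)
    (s t : ℕ) (hs : 0 < s) (ht : 0 < t)
    (I : Fin s → Finset ℕ) (hI : ∀ l : Fin s, s * t ≤ nrm (I l)) :
    ∃ π : Equiv.Perm (Fin s), ∃ J : Fin s → Finset ℕ,
      (∀ i, J i ⊆ I (π i)) ∧ (∀ i, nrm (J i) = t) ∧
      (∀ i j : Fin s, i < j → ∀ a ∈ J i, ∀ b ∈ J j, a < b) := by
  obtain ⟨f, J, hf, _, h1, h2, h3⟩ := roberts_aux nrm hn t ht s Finset.univ I (by simp)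
    (fun l _ => hI l)
  exact ⟨Equiv.ofBijective f (Finite.injective_iff_bijective.1 hf), J, h1, h2, h3⟩
end

section
/- Let ‖·‖ be an admissible norm and let C, D be finite subsets of ℕ with ‖C‖ ≥ 3 and ‖D‖ = 1. Then there are consecutive elements c < d of C (i.e. c, d ∈ C with no element of C strictly between them) such that [c, d) ∩ D = ∅. -/
open Ordinal Filter
open scoped ENNReal
theorem spreadLE_image (A : Finset ℕ) (f : ℕ → ℕ) (h1 : ∀ a ∈ A, a ≤ f a)
    (h2 : ∀ a ∈ A, ∀ b ∈ A, a < b → f a < f b) : SpreadLE A (A.image f) := by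
  have key : (A.image f).sort (· ≤ ·) = (A.sort (· ≤ ·)).map f := by
    have hp : ((A.sort (· ≤ ·)).map f).Pairwise (· < ·) := by
      rw [List.pairwise_map]
      refine List.Pairwise.imp_of_mem ?_ (Finset.sortedLT_sort A).pairwise
      intro a b ha hb hab
      exact h2 a (by simpa using ha) b (by simpa using hb) hab
    refine List.Perm.eq_of_pairwise (le := (· ≤ ·)) (fun a b _ _ h h' => le_antisymm h h') (Finset.pairwise_sort _ _) (hp.imp le_of_lt) ?_
    rw [List.perm_ext_iff_of_nodup (Finset.sort_nodup _ _) (hp.imp ne_of_lt)]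
    intro a
    simp
  unfold SpreadLE
  rw [key, List.forall₂_map_right_iff, List.forall₂_same]
  intro x hx
  exact h1 x (by simpa using hx)

/-- If `‖C‖ ≥ 3` and `‖D‖ = 1` for an admissible norm, then there are consecutive
elements `c < d` of `C` with `[c,d) ∩ D = ∅`. -/
theorem zapping (nrm : Finset ℕ → ℕ) (hn : IsAdmissibleNorm nrm)
    (C D : Finset ℕ) (hC : 3 ≤ nrm C) (hD : nrm D = 1) :
    ∃ c ∈ C, ∃ d ∈ C, c < d ∧ (∀ x ∈ C, ¬(c < x ∧ x < d)) ∧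
      ∀ x ∈ D, ¬(c ≤ x ∧ x < d) := by
  by_contra hcon
  have hne : C.Nonempty := by
    rw [Finset.nonempty_iff_ne_empty]
    rintro rfl
    rw [hn.empty] at hC
    omega
  have hex : ∀ c, ∃ y, c ∈ C.erase (C.max' hne) →
      y ∈ D ∧ c ≤ y ∧ ∀ d ∈ C, c < d → y < d := by
    intro c
    by_cases hc : c ∈ C.erase (C.max' hne)
    · have hcC := Finset.mem_of_mem_erase hc
      have hlt : c < C.max' hne :=
        lt_of_le_of_ne (C.le_max' c hcC) (Finset.ne_of_mem_erase hc)
      have hF : (C.filter (c < ·)).Nonempty :=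
        ⟨C.max' hne, Finset.mem_filter.2 ⟨C.max'_mem hne, hlt⟩⟩
      set d := (C.filter (c < ·)).min' hF with hd
      have hdm := Finset.mem_filter.1 ((C.filter (c < ·)).min'_mem hF)
      have hmin : ∀ x ∈ C, c < x → d ≤ x := fun x hx hcx =>
        Finset.min'_le _ x (Finset.mem_filter.2 ⟨hx, hcx⟩)
      by_contra hno
      refine hcon ⟨c, hcC, d, hdm.1, hdm.2, ?_, ?_⟩
      · rintro x hx ⟨h1, h2⟩
        exact absurd (hmin x hx h1) (not_le.2 h2)
      · rintro x hx ⟨h1, h2⟩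
        exact hno ⟨x, fun _ => ⟨hx, h1, fun e he hce => lt_of_lt_of_le h2 (hmin e he hce)⟩⟩
    · exact ⟨0, fun h => absurd h hc⟩
  choose f hf using hex
  have hs := hn.spreading _ _ (spreadLE_image (C.erase (C.max' hne)) f
    (fun a ha => (hf a ha).2.1)
    (fun a ha b hb hab => lt_of_lt_of_le
      ((hf a ha).2.2 b (Finset.mem_of_mem_erase hb) hab) (hf b hb).2.1))
  have hm := hn.mono ((C.erase (C.max' hne)).image f) D
    (Finset.image_subset_iff.2 fun a ha => (hf a ha).1)
  have hu := hn.subadd {C.max' hne} (C.erase (C.max' hne))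
  rw [← Finset.insert_eq, Finset.insert_erase (C.max'_mem hne), hn.singleton] at hu
  omega
end

section
/- Let ‖·‖ be an admissible norm. Suppose t ≥ 5, and J_0 < … < J_{s-1} are finite subsets of ℕ (each element of J_i is less than each element of J_{i+1}) with ‖J_i‖ ≥ t for all i < s. Let 𝓕 be a finite subset of [ℕ]^{<ω} × (0,∞) and set a = Σ_{(I,w)∈𝓕} w. Then there exist m_i < n_i with m_i, n_i ∈ J_i for each i < s such that: (1) ‖J_i ∩ [m_i, n_i)‖ ≥ 3 for all i < s; and (2) setting W = ⋃_{i<s} [m_i, n_i) and 𝓓 = {(I,w) ∈ 𝓕 : ‖I \ W‖ < ‖I‖/2}, we have Σ_{(I,w)∈𝓓} w ≤ 3a/(t−4). -/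
open Ordinal Filter
open scoped ENNReal
theorem ws_step (nrm : Finset ℕ → ℕ) (hn : IsAdmissibleNorm nrm) (A : Finset ℕ) (x : ℕ)
    (hx : x ∈ A) (h4 : 4 ≤ nrm (A.filter (fun z => x ≤ z))) :
    ∃ y ∈ A, x < y ∧ 3 ≤ nrm (A ∩ Finset.Ico x y) ∧
      nrm (A.filter (fun z => x ≤ z)) ≤ nrm (A.filter (fun z => y ≤ z)) + 3 := by
  classical
  have hex : ∃ y, y ∈ A ∧ 3 ≤ nrm (A ∩ Finset.Ico x y) := by
    refine ⟨A.max' ⟨x, hx⟩, A.max'_mem _, ?_⟩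
    have hsub : A.filter (fun z => x ≤ z) ⊆
        (A ∩ Finset.Ico x (A.max' ⟨x, hx⟩)) ∪ {A.max' ⟨x, hx⟩} := by
      intro z hz
      have hz' := Finset.mem_filter.1 hz
      have := A.le_max' z hz'.1
      simp only [Finset.mem_union, Finset.mem_inter, Finset.mem_Ico, Finset.mem_singleton]
      rcases this.lt_or_eq with h | h
      · exact Or.inl ⟨hz'.1, hz'.2, h⟩
      · exact Or.inr h
    have h1 := hn.mono _ _ hsub
    have h2 := hn.subadd (A ∩ Finset.Ico x (A.max' ⟨x, hx⟩)) {A.max' ⟨x, hx⟩}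
    rw [hn.singleton] at h2
    omega
  let y := Nat.find hex
  obtain ⟨hyA, hy3⟩ : y ∈ A ∧ 3 ≤ nrm (A ∩ Finset.Ico x y) := Nat.find_spec hex
  have hmin : ∀ z ∈ A, z < y → nrm (A ∩ Finset.Ico x z) ≤ 2 := by
    intro z hz hzy
    have := Nat.find_min hex hzy
    by_contra hc
    exact this ⟨hz, by omega⟩
  have hxy : x < y := by
    by_contra hc
    rw [Finset.Ico_eq_empty hc, Finset.inter_empty, hn.empty] at hy3
    omega
  refine ⟨y, hyA, hxy, hy3, ?_⟩
  have hne : (A ∩ Finset.Ico x y).Nonempty :=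
    ⟨x, Finset.mem_inter.2 ⟨hx, Finset.mem_Ico.2 ⟨le_rfl, hxy⟩⟩⟩
  obtain ⟨z, hz, hzmax⟩ : ∃ z ∈ A ∩ Finset.Ico x y, ∀ u ∈ A ∩ Finset.Ico x y, u ≤ z :=
    ⟨_, Finset.max'_mem _ hne, fun u hu => Finset.le_max' _ u hu⟩
  have hz' := Finset.mem_inter.1 hz
  have hz2 := hmin z hz'.1 (Finset.mem_Ico.1 hz'.2).2
  have hsub : A.filter (fun z => x ≤ z) ⊆
      A.filter (fun z => y ≤ z) ∪ ((A ∩ Finset.Ico x z) ∪ {z}) := by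
    intro u hu
    have hu' := Finset.mem_filter.1 hu
    have hm := hzmax u
    simp only [Finset.mem_union, Finset.mem_inter, Finset.mem_Ico, Finset.mem_singleton,
      Finset.mem_filter] at hm ⊢
    have h1 := hu'.1
    have h2 := hu'.2
    by_cases h3 : y ≤ u
    · exact Or.inl ⟨h1, h3⟩
    · have := hm ⟨h1, h2, by omega⟩
      rcases this.lt_or_eq with h | h
      · exact Or.inr (Or.inl ⟨h1, h2, h⟩)
      · exact Or.inr (Or.inr h)
  have h1 := hn.mono _ _ hsub
  have h2 := hn.subadd (A.filter (fun z => y ≤ z)) ((A ∩ Finset.Ico x z) ∪ {z})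
  have h3 := hn.subadd (A ∩ Finset.Ico x z) {z}
  rw [hn.singleton] at h3
  omega

theorem ws_chain (nrm : Finset ℕ → ℕ) (hn : IsAdmissibleNorm nrm) (A : Finset ℕ) (k : ℕ) :
    ∀ x ∈ A, 3 * k + 1 ≤ nrm (A.filter (fun z => x ≤ z)) →
    ∃ p : ℕ → ℕ, p 0 = x ∧ (∀ j ≤ k, p j ∈ A) ∧ (∀ j l, j < l → l ≤ k → p j < p l) ∧
      ∀ j < k, 3 ≤ nrm (A ∩ Finset.Ico (p j) (p (j + 1))) := by
  induction k with
  | zero =>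
    intro x hx _
    refine ⟨fun _ => x, rfl, fun _ _ => hx, ?_, ?_⟩ <;> intros <;> omega
  | succ k ih =>
    intro x hx h
    obtain ⟨y, hy, hxy, h3, hle⟩ := ws_step nrm hn A x hx (by omega)
    obtain ⟨q, q0, qA, qm, q3⟩ := ih y hy (by omega)
    refine ⟨fun j => Nat.casesOn j x q, rfl, ?_, ?_, ?_⟩
    · intro j hj
      cases j with
      | zero => exact hx
      | succ j => exact qA j (by omega)
    · intro j l hjl hl
      cases l with
      | zero => omega
      | succ l =>
        cases j with
        | zero =>
          show x < q l
          rcases Nat.eq_zero_or_pos l with h0 | h0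
          · rw [h0, q0]; exact hxy
          · have := qm 0 l h0 (by omega)
            omega
        | succ j => exact qm j l (by omega) (by omega)
    · intro j hj
      cases j with
      | zero =>
        show 3 ≤ nrm (A ∩ Finset.Ico x (q 0))
        rw [q0]; exact h3
      | succ j => exact q3 j (by omega)

/-- The key selection lemma: given consecutive blocks `J₀ < … < J_{s-1}` of norm `≥ t ≥ 5`
and a finite weighted family `𝓕` with total weight `a`, one can choose `mᵢ < nᵢ` in `Jᵢ`
with `‖Jᵢ ∩ [mᵢ,nᵢ)‖ ≥ 3` such that the pairs `(I,w) ∈ 𝓕` with `‖I \ W‖ < ‖I‖/2`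
(where `W = ⋃ᵢ [mᵢ,nᵢ)`) have total weight at most `3a/(t-4)`. -/
theorem weighted_selection (nrm : Finset ℕ → ℕ) (hn : IsAdmissibleNorm nrm)
    (s t : ℕ) (ht : 5 ≤ t) (J : Fin s → Finset ℕ) (hJ : ∀ i, t ≤ nrm (J i))
    (hord : ∀ i j : Fin s, i < j → ∀ a ∈ J i, ∀ b ∈ J j, a < b)
    (F : Finset (Finset ℕ × ℝ)) (hw : ∀ p ∈ F, 0 < p.2) :
    ∃ m n : Fin s → ℕ, (∀ i, m i ∈ J i) ∧ (∀ i, n i ∈ J i) ∧ (∀ i, m i < n i) ∧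
      (∀ i, 3 ≤ nrm (J i ∩ Finset.Ico (m i) (n i))) ∧
      ∑ p ∈ F.filter (fun p =>
          2 * nrm (p.1 \ Finset.univ.biUnion fun i => Finset.Ico (m i) (n i)) < nrm p.1),
        p.2 ≤ 3 * (∑ p ∈ F, p.2) / ((t : ℝ) - 4) := by
  classical
  obtain ⟨k, hk1, hk2, hk3⟩ : ∃ k : ℕ, 3 * k + 1 ≤ t ∧ t ≤ 3 * k + 4 ∧ 1 ≤ k :=
    ⟨(t - 1) / 3, by omega, by omega, by omega⟩
  have hc : ∀ i, ∃ p : ℕ → ℕ, (∀ j ≤ k, p j ∈ J i) ∧ (∀ j l, j < l → l ≤ k → p j < p l) ∧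
      ∀ j < k, 3 ≤ nrm (J i ∩ Finset.Ico (p j) (p (j + 1))) := by
    intro i
    have hne : (J i).Nonempty := by
      by_contra h
      have h0 := hJ i
      rw [Finset.not_nonempty_iff_eq_empty.1 h, hn.empty] at h0
      omega
    have hf : (J i).filter (fun z => (J i).min' hne ≤ z) = J i :=
      Finset.filter_true_of_mem fun z hz => Finset.min'_le _ z hz
    obtain ⟨p, -, h⟩ := ws_chain nrm hn (J i) k ((J i).min' hne) (Finset.min'_mem _ _)
      (by rw [hf]; exact hk1.trans (hJ i))
    exact ⟨p, h⟩
  choose p pA pm p3 using hc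
  let W : ℕ → Finset ℕ := fun j => Finset.univ.biUnion fun i => Finset.Ico (p i j) (p i (j + 1))
  let D : ℕ → Finset (Finset ℕ × ℝ) := fun j =>
    F.filter (fun q => 2 * nrm (q.1 \ W j) < nrm q.1)
  have hWd : ∀ j l, j < l → l < k → ∀ x, x ∈ W j → x ∈ W l → False := by
    intro j l hjl hl x hxj hxl
    simp only [W, Finset.mem_biUnion, Finset.mem_univ, true_and, Finset.mem_Ico] at hxj hxl
    obtain ⟨i, h1, h2⟩ := hxj
    obtain ⟨i', h3, h4⟩ := hxl
    rcases lt_trichotomy i i' with h | h | h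
    · have := hord i i' h _ (pA i (j + 1) (by omega)) _ (pA i' l (by omega))
      omega
    · subst h
      rcases Nat.lt_or_ge (j + 1) l with h | h
      · have := pm i (j + 1) l h (by omega)
        omega
      · have : l = j + 1 := by omega
        subst this
        omega
    · have := hord i' i h _ (pA i' (l + 1) (by omega)) _ (pA i j (by omega))
      omega
  have hDlt : ∀ j l, j < l → l < k → ∀ q, q ∈ D j → q ∈ D l → False := by
    intro j l hjl hl q hj hl'
    have h1 := (Finset.mem_filter.1 hj).2
    have h2 := (Finset.mem_filter.1 hl').2
    have hsub : q.1 ⊆ (q.1 \ W j) ∪ (q.1 \ W l) := by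
      intro x hx
      have := hWd j l hjl hl x
      simp only [Finset.mem_union, Finset.mem_sdiff]
      tauto
    have h3 := hn.mono _ _ hsub
    have h4 := hn.subadd (q.1 \ W j) (q.1 \ W l)
    omega
  have hpd : Set.PairwiseDisjoint (↑(Finset.range k) : Set ℕ) D := by
    intro j hj l hl hne
    have hj' := Finset.mem_range.1 (Finset.mem_coe.1 hj)
    have hl' := Finset.mem_range.1 (Finset.mem_coe.1 hl)
    refine Finset.disjoint_left.2 fun q h1 h2 => ?_
    rcases Nat.lt_or_gt_of_ne hne with h | h
    · exact hDlt j l h hl' q h1 h2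
    · exact hDlt l j h hj' q h2 h1
  have hsum : ∑ j ∈ Finset.range k, ∑ q ∈ D j, q.2 ≤ ∑ q ∈ F, q.2 := by
    rw [← Finset.sum_biUnion hpd]
    refine Finset.sum_le_sum_of_subset_of_nonneg ?_ fun q hq _ => (hw q hq).le
    exact Finset.biUnion_subset.2 fun j _ => Finset.filter_subset _ _
  have hkpos : (0 : ℝ) < k := by exact_mod_cast hk3
  obtain ⟨j, hj, hjle⟩ : ∃ j ∈ Finset.range k,
      ∑ q ∈ D j, q.2 ≤ (∑ q ∈ F, q.2) / k := by
    refine Finset.exists_le_of_sum_le (Finset.nonempty_range_iff.2 (by omega)) ?_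
    rw [Finset.sum_const, Finset.card_range, _root_.nsmul_eq_mul]
    have he : (k : ℝ) * ((∑ q ∈ F, q.2) / k) = ∑ q ∈ F, q.2 := by field_simp
    rw [he]
    exact hsum
  have hjk := Finset.mem_range.1 hj
  refine ⟨fun i => p i j, fun i => p i (j + 1), fun i => pA i j (by omega),
    fun i => pA i (j + 1) (by omega), fun i => pm i j (j + 1) (by omega) (by omega),
    fun i => p3 i j hjk, ?_⟩
  have ha : 0 ≤ ∑ q ∈ F, q.2 := Finset.sum_nonneg fun q hq => (hw q hq).le
  have ht5 : (5 : ℝ) ≤ t := by exact_mod_cast ht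
  have hk2' : (t : ℝ) ≤ 3 * k + 4 := by exact_mod_cast hk2
  have hfin : (∑ q ∈ F, q.2) / k ≤ 3 * (∑ q ∈ F, q.2) / ((t : ℝ) - 4) := by
    rw [div_le_div_iff₀ hkpos (by linarith)]
    nlinarith
  refine le_trans (le_of_eq ?_) (hjle.trans hfin)
  apply Finset.sum_congr
  · ext q
    simp only [D, W, Finset.mem_filter]
  · intros; rfl
end

section
/- Let k ≤ p and m be integers, let (X, I, w) ∈ C_{k,p}, and let A ∈ 𝒜_m. Suppose n > m and I' = I ∩ [m, n) is non-empty. Set X' = [π_A^{-1}(X ∩ A)]_n, the smallest member of ℬ_n containing π_A^{-1}(X ∩ A), and w' = w·(‖I‖/‖I'‖)^{a_k}. Then (X', I', w') ∈ C_{k,p}. -/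
open Ordinal Filter
open scoped ENNReal
/-- The space `T = ∏ₙ 2ⁿ`. -/
abbrev TT : Type := (n : ℕ) → Fin (2 ^ n)

/-- The atom of rank `m` (basic cylinder) determined by the first `m` coordinates of `x`;
the atoms of `ℬ_m` are exactly the sets `cylSet m x`. -/
def cylSet (m : ℕ) (x : TT) : Set TT := {y | ∀ i < m, y i = x i}

/-- Membership in `ℬ_n`: the set depends only on coordinates `< n`. -/
def memB (n : ℕ) (X : Set TT) : Prop :=
  ∀ x y : TT, (∀ i < n, x i = y i) → (x ∈ X ↔ y ∈ X)

/-- `X` does not depend on coordinates `< m`. -/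
def indepBelow (m : ℕ) (X : Set TT) : Prop :=
  ∀ x y : TT, (∀ i, m ≤ i → x i = y i) → (x ∈ X ↔ y ∈ X)

/-- The retraction `π_A : T → A` for the atom `A = cylSet m x`. -/
def piMap (m : ℕ) (x : TT) (z : TT) : TT := fun i => if i < m then x i else z i

/-- `[X]_n`: the smallest member of `ℬ_n` containing `X`. -/
def clsn (n : ℕ) (X : Set TT) : Set TT := {y | ∃ x ∈ X, ∀ i < n, y i = x i}

/-- `int_n(X)`: the largest member of `ℬ_n` contained in `X`. -/
def intn (n : ℕ) (X : Set TT) : Set TT := {y | cylSet n y ⊆ X}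

/-- A submeasure on the algebra `ℬ` of clopen subsets of `T`. -/
structure IsSubmeasureOn (ν : Set TT → ℝ≥0∞) : Prop where
  empty : ν ∅ = 0
  mono : ∀ X Y : Set TT, IsClopen X → IsClopen Y → X ⊆ Y → ν X ≤ ν Y
  subadd : ∀ X Y : Set TT, IsClopen X → IsClopen Y → ν (X ∪ Y) ≤ ν X + ν Y

/-- The outer submeasure `φ_𝓔` associated to a class `𝓔` of marked weighted sets:
the infimum of total weights of finite subfamilies covering `X` (and `+∞` if there is
no such cover). -/
noncomputable def phiE (E : Set (Set TT × Finset ℕ × ℝ≥0∞)) (X : Set TT) : ℝ≥0∞ :=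
  ⨅ (F : Finset (Set TT × Finset ℕ × ℝ≥0∞)) (_ : ↑F ⊆ E) (_ : X ⊆ ⋃ c ∈ F, c.1),
    ∑ c ∈ F, c.2.2

/-- `X` is `(m,n,φ)`-thin. -/
def IsThin (φ : Set TT → ℝ≥0∞) (m n : ℕ) (X : Set TT) : Prop :=
  ∀ x : TT, ∃ H : Set TT, memB n H ∧ H ⊆ cylSet m x \ X ∧ 1 < φ (piMap m x ⁻¹' H)

/-- `X` is `(I,φ)`-thin. -/
def IsThinOn (φ : Set TT → ℝ≥0∞) (I : Finset ℕ) (X : Set TT) : Prop :=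
  ∀ m ∈ I, ∀ n ∈ I, m < n → IsThin φ m n X

/-- `a_k = 1/(k+5)³`. -/
noncomputable def aK (k : ℕ) : ℝ := 1 / ((k : ℝ) + 5) ^ 3

/-- `M_k = 2^{2k+12} · 2^{(k+4)(k+5)³}`. -/
def MK (k : ℕ) : ℕ := 2 ^ (2 * k + 12) * 2 ^ ((k + 4) * (k + 5) ^ 3)

/-- The weight bound `2^{-k} (M_k / ‖I‖)^{a_k}`. -/
noncomputable def weightBound (nrm : Finset ℕ → ℕ) (k : ℕ) (I : Finset ℕ) : ℝ≥0∞ :=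
  (2 : ℝ≥0∞) ^ (-(k : ℝ)) * ((MK k : ℝ≥0∞) / (nrm I : ℝ≥0∞)) ^ aK k

/-- The class `E_{k,p}` built from the submeasure `φ = ν_{k+1,p}`. -/
noncomputable def EEcl (nrm : Finset ℕ → ℕ) (φ : Set TT → ℝ≥0∞) (k : ℕ) :
    Set (Set TT × Finset ℕ × ℝ≥0∞) :=
  {c | IsClopen c.1 ∧ nrm c.2.1 ≤ MK k ∧ weightBound nrm k c.2.1 ≤ c.2.2 ∧
       IsThinOn φ c.2.1 c.1}

/-- `Cstage nrm p j = C_{p-j, p}`, defined by downward recursion on `k = p - j`. -/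
noncomputable def Cstage (nrm : Finset ℕ → ℕ) (p : ℕ) : ℕ → Set (Set TT × Finset ℕ × ℝ≥0∞)
  | 0 => ∅
  | j + 1 => Cstage nrm p j ∪ EEcl nrm (phiE (Cstage nrm p j)) (p - (j + 1))

/-- The family `C_{k,p}`. -/
noncomputable def Ckp (nrm : Finset ℕ → ℕ) (k p : ℕ) : Set (Set TT × Finset ℕ × ℝ≥0∞) :=
  Cstage nrm p (p - k)

/-- The submeasure `ν_{k,p} = φ_{C_{k,p}}`. -/
noncomputable def nuKP (nrm : Finset ℕ → ℕ) (k p : ℕ) : Set TT → ℝ≥0∞ :=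
  phiE (Ckp nrm k p)

/-- The ultrafilter-limit submeasure `ν_k(E) = lim_{p→𝒰} ν_{k,p}(E)`. -/
noncomputable def nuK (nrm : Finset ℕ → ℕ) (U : Ultrafilter ℕ) (k : ℕ) (X : Set TT) : ℝ≥0∞ :=
  limUnder (U : Filter ℕ) fun p => nuKP nrm k p X

theorem mem_Cstage_iff' (nrm : Finset ℕ → ℕ) (p j : ℕ) (c : Set TT × Finset ℕ × ℝ≥0∞) :
    c ∈ Cstage nrm p j ↔
      ∃ i < j, c ∈ EEcl nrm (phiE (Cstage nrm p i)) (p - (i + 1)) := by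
  induction j with
  | zero => simp [Cstage]
  | succ j ih =>
    rw [Cstage, Set.mem_union, ih]
    constructor
    · rintro (⟨i, hi, h⟩ | h)
      · exact ⟨i, by omega, h⟩
      · exact ⟨j, by omega, h⟩
    · rintro ⟨i, hi, h⟩
      rcases Nat.lt_succ_iff_lt_or_eq.1 hi with h1 | h1
      · exact Or.inl ⟨i, h1, h⟩
      · subst h1; exact Or.inr h

theorem isOpen_of_memB' (n : ℕ) (X : Set TT) (h : memB n X) : IsOpen X := by
  rw [isOpen_iff_mem_nhds]
  intro x hx
  have h1 : (⋂ i ∈ Finset.range n, {y : TT | y i = x i}) ∈ nhds x := by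
    rw [Filter.biInter_finset_mem]
    intro i _
    have h2 : IsOpen ((fun y : TT => y i) ⁻¹' {x i}) :=
      (isOpen_discrete _).preimage (continuous_apply i)
    exact h2.mem_nhds rfl
  refine Filter.mem_of_superset h1 fun y hy => ?_
  simp only [Set.mem_iInter, Finset.mem_range, Set.mem_setOf_eq] at hy
  exact (h y x hy).2 hx

theorem isClopen_of_memB' (n : ℕ) (X : Set TT) (h : memB n X) : IsClopen X :=
  ⟨⟨isOpen_of_memB' n _ fun x y hxy => not_congr (h x y hxy)⟩, isOpen_of_memB' n X h⟩

theorem memB_clsn' (n : ℕ) (X : Set TT) : memB n (clsn n X) := by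
  intro x y h
  constructor
  · rintro ⟨z, hz, hh⟩
    exact ⟨z, hz, fun i hi => (h i hi).symm.trans (hh i hi)⟩
  · rintro ⟨z, hz, hh⟩
    exact ⟨z, hz, fun i hi => (h i hi).trans (hh i hi)⟩

theorem isThin_restrict' (φ : Set TT → ℝ≥0∞) (m n a b : ℕ) (x : TT) (X : Set TT)
    (hma : m ≤ a) (hab : a < b) (hbn : b < n) (h : IsThin φ a b X) :
    IsThin φ a b (clsn n (piMap m x ⁻¹' (X ∩ cylSet m x))) := by
  intro y
  obtain ⟨H, hB, hsub, hφ⟩ := h (piMap m x y)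
  refine ⟨cylSet a y ∩ piMap m x ⁻¹' H, ?_, ?_, ?_⟩
  · intro u v huv
    have h1 : u ∈ cylSet a y ↔ v ∈ cylSet a y := by
      simp only [cylSet, Set.mem_setOf_eq]
      exact forall₂_congr fun i hi => by rw [huv i (by omega)]
    have h2 := hB (piMap m x u) (piMap m x v) fun i hi => by
      simp only [piMap]; rw [huv i hi]
    exact and_congr h1 h2
  · rintro z ⟨hz, hzH⟩
    refine ⟨hz, ?_⟩
    rintro ⟨u, ⟨huX, _⟩, hzu⟩
    have h2 := hB (piMap m x z) (piMap m x u) fun i hi => by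
      simp only [piMap]; rw [hzu i (by omega)]
    exact (hsub (h2.1 hzH)).2 huX
  · convert hφ using 2
    ext z
    have e : piMap m x (piMap a y z) = piMap a (piMap m x y) z := by
      funext i
      simp only [piMap]
      split_ifs <;> first | rfl | omega
    have hc : piMap a y z ∈ cylSet a y := fun i hi => by simp [piMap, hi]
    simp only [Set.mem_preimage, Set.mem_inter_iff, hc, true_and, e]

theorem weight_restrict' (M s t : ℝ≥0∞) (q w : ℝ≥0∞) (a b : ℝ) (ha : 0 ≤ a) (hab : a ≤ b)
    (hs0 : t ≠ 0) (hst : t ≤ s) (hs : s ≠ ⊤) (h : q * (M / s) ^ a ≤ w) :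
    q * (M / t) ^ a ≤ w * (s / t) ^ b := by
  have ht : t ≠ ⊤ := ne_top_of_le_ne_top hs hst
  have h0 : s ≠ 0 := fun h => hs0 (by simpa [h] using hst)
  have h1 : (1 : ℝ≥0∞) ≤ s / t := by
    rw [ENNReal.le_div_iff_mul_le (Or.inl hs0) (Or.inl ht)]; simpa using hst
  have e : M / t = (M / s) * (s / t) := by
    rw [div_eq_mul_inv, div_eq_mul_inv, div_eq_mul_inv, mul_assoc, ← mul_assoc s⁻¹,
      ENNReal.inv_mul_cancel h0 hs, one_mul]
  rw [e, ENNReal.mul_rpow_of_nonneg _ _ ha, ← mul_assoc]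
  exact mul_le_mul' h (ENNReal.rpow_le_rpow_of_exponent_le h1 hab)

theorem aK_nonneg' (k : ℕ) : 0 ≤ aK k := by unfold aK; positivity

theorem aK_anti' {k r : ℕ} (h : k ≤ r) : aK r ≤ aK k := by
  unfold aK
  have : (k : ℝ) ≤ r := by exact_mod_cast h
  gcongr

/-- Lemma 3.4: if `(X, I, w) ∈ C_{k,p}`, `A = cylSet m x ∈ 𝒜_m`, `n > m`, and
`I' = I ∩ [m,n)` is nonempty, then `(X', I', w') ∈ C_{k,p}` where
`X' = [π_A⁻¹(X ∩ A)]_n` and `w' = w·(‖I‖/‖I'‖)^{a_k}`. -/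
theorem restriction_in_Ckp (nrm : Finset ℕ → ℕ) (hn : IsAdmissibleNorm nrm)
    (k p : ℕ) (hkp : k ≤ p) (X : Set TT) (I : Finset ℕ) (w : ℝ≥0∞)
    (hmem : (X, I, w) ∈ Ckp nrm k p) (m n : ℕ) (hmn : m < n) (x : TT)
    (hne : (I ∩ Finset.Ico m n).Nonempty) :
    (clsn n (piMap m x ⁻¹' (X ∩ cylSet m x)), I ∩ Finset.Ico m n,
        w * ((nrm I : ℝ≥0∞) / (nrm (I ∩ Finset.Ico m n) : ℝ≥0∞)) ^ aK k)
      ∈ Ckp nrm k p := by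
  rw [Ckp, mem_Cstage_iff'] at hmem ⊢
  obtain ⟨i, hi, -, hM, hw, hT⟩ := hmem
  have hle : nrm (I ∩ Finset.Ico m n) ≤ nrm I := hn.mono _ _ Finset.inter_subset_left
  have hpos : nrm (I ∩ Finset.Ico m n) ≠ 0 := by
    obtain ⟨a, ha⟩ := hne
    have := hn.mono _ _ (Finset.singleton_subset_iff.2 ha)
    rw [hn.singleton] at this
    omega
  refine ⟨i, hi, isClopen_of_memB' n _ (memB_clsn' n _), hle.trans hM, ?_, ?_⟩
  · exact weight_restrict' _ _ _ _ _ _ _ (aK_nonneg' _) (aK_anti' (by omega))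
      (by exact_mod_cast hpos) (by exact_mod_cast hle) (ENNReal.natCast_ne_top _) hw
  · intro a ha b hb hab
    simp only [Finset.mem_inter, Finset.mem_Ico] at ha hb
    exact isThin_restrict' _ m n a b x X ha.2.1 hab hb.2.2 (hT a ha.1 b hb.1 hab)
end
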